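/- Let n ≥ 2 and ℓ be a positive integer, and let a_1,…,a_n, f_1,…,f_n ∈ K^*. Suppose a_1 f_1^ℓ + ⋯ + a_n f_n^ℓ = 0 and no proper subsum of a_1 f_1^ℓ + ⋯ + a_n f_n^ℓ vanishes. If ℓ > (n−1)^2(n−2)·max{1, 𝔤} + (n−1)^4·h(a_1,…,a_n), then f_i/f_j ∈ k for all 1 ≤ i, j ≤ n. -/

import Mathlib

open scoped BigOperators Classical

namespace FunctionFieldGCD

variable {K : Type*} [Field K] {Point : Type*}

/-- Truncated order of vanishing `v_𝔭^0(f) = max {0, v_𝔭(f)}`. -/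
noncomputable def v0 (v : Point → K → ℤ) (p : Point) (f : K) : ℤ := max 0 (v p f)

/-- The height `h(f) = Σ_𝔭 −min{0, v_𝔭(f)}` of `f`, counting poles with multiplicity. -/
noncomputable def height (v : Point → K → ℤ) (f : K) : ℤ := ∑ᶠ p : Point, max 0 (-(v p f))

/-- `min {v_𝔭^0(f), v_𝔭^0(g)}` with the convention `v_𝔭^0(0) = +∞`. -/
noncomputable def minv0 (v : Point → K → ℤ) (p : Point) (f g : K) : ℤ :=
  if f = 0 then v0 v p g else if g = 0 then v0 v p f else min (v0 v p f) (v0 v p g)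

/-- `N_{S,gcd}(f,g) = Σ_{𝔭∉S} min{v_𝔭^0(f), v_𝔭^0(g)}`. -/
noncomputable def NSgcd (v : Point → K → ℤ) (S : Set Point) (f g : K) : ℤ :=
  ∑ᶠ p ∈ Sᶜ, minv0 v p f g

/-- `h_gcd(f,g) = Σ_{𝔭} min{v_𝔭^0(f), v_𝔭^0(g)}`. -/
noncomputable def hgcd (v : Point → K → ℤ) (f g : K) : ℤ :=
  ∑ᶠ p : Point, minv0 v p f g

/-- `N_S(f)`: number of zeros of `f` outside `S`, with multiplicity. -/
noncomputable def NS (v : Point → K → ℤ) (S : Set Point) (f : K) : ℤ :=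
  ∑ᶠ p ∈ Sᶜ, v0 v p f

/-- `N̄_S(f)`: number of zeros of `f` outside `S`, without multiplicity. -/
noncomputable def NSbar (v : Point → K → ℤ) (S : Set Point) (f : K) : ℤ :=
  ∑ᶠ p ∈ Sᶜ, min 1 (v0 v p f)

/-- membership in the group `O_S^*` of `S`-units. -/
def IsSUnit (v : Point → K → ℤ) (S : Set Point) (f : K) : Prop :=
  f ≠ 0 ∧ ∀ p ∉ S, v p f = 0

/-- `f` is a constant, i.e. belongs to (the image of) `k`. -/
def IsConst (k : Type*) [Field k] [Algebra k K] (f : K) : Prop :=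
  ∃ c : k, algebraMap k K c = f

/-- Projective height of a finite tuple: `h(f_0,…,f_m) = Σ_𝔭 −min_j v_𝔭(f_j)`. -/
noncomputable def heightProj {ι : Type*} [Fintype ι] (v : Point → K → ℤ) (f : ι → K) : ℤ :=
  ∑ᶠ p : Point,
    -(if h : (Finset.univ : Finset ι).Nonempty then Finset.univ.inf' h fun j => v p (f j) else 0)

/-- `v_𝔭(F) = min_{i ∈ I_F} v_𝔭(a_i)` for a multivariable polynomial `F = Σ a_i x^i`. -/
noncomputable def vPoly {n : ℕ} (v : Point → K → ℤ) (p : Point) (F : MvPolynomial (Fin n) K) :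
    ℤ :=
  if h : F.support.Nonempty then F.support.inf' h fun mm => v p (MvPolynomial.coeff mm F) else 0

/-- The height `h(F) = Σ_𝔭 −v_𝔭(F)` of a multivariable polynomial. -/
noncomputable def hPoly {n : ℕ} (v : Point → K → ℤ) (F : MvPolynomial (Fin n) K) : ℤ :=
  ∑ᶠ p : Point, -(vPoly v p F)

/-- The relevant height `h̃(F) = Σ_𝔭 −min{0, v_𝔭(F)}` of a multivariable polynomial. -/
noncomputable def htilde {n : ℕ} (v : Point → K → ℤ) (F : MvPolynomial (Fin n) K) : ℤ :=
  ∑ᶠ p : Point, max 0 (-(vPoly v p F))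

/-- `max_{1≤i≤n} h(g_i)` (heights are nonnegative, so the `toNat` is harmless). -/
noncomputable def maxHeight {n : ℕ} (v : Point → K → ℤ) (g : Fin n → K) : ℤ :=
  ((Finset.univ.sup fun i => (height v (g i)).toNat : ℕ) : ℤ)

/-- `u^m = u_1^{m_1} ⋯ u_n^{m_n}` for an integer exponent vector `m`. -/
noncomputable def prodZPow {n : ℕ} (u : Fin n → K) (mm : Fin n → ℤ) : K :=
  ∏ j, u j ^ mm j

/-- Coprimality of multivariable polynomials: no common non-unit factor. -/
def CoprimePoly {n : ℕ} (F G : MvPolynomial (Fin n) K) : Prop :=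
  ∀ P : MvPolynomial (Fin n) K, P ∣ F → P ∣ G → IsUnit P

/-- `P` is a monomial `a·x^i`. -/
def IsMonomialPoly {n : ℕ} (P : MvPolynomial (Fin n) K) : Prop :=
  ∃ (mm : Fin n →₀ ℕ) (a : K), P = MvPolynomial.monomial mm a

/-- Axioms expressing that `K`, equipped with the family of normalized order functions
`v_𝔭` indexed by the points `𝔭 ∈ C(k)` of a smooth projective curve `C` of genus `genus`
over the algebraically closed field `k`, is the function field `k(C)`. -/
structure IsFunctionField (k : Type*) [Field k] [Algebra k K]
    (v : Point → K → ℤ) (genus : ℕ) : Prop where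
  v_mul : ∀ (p : Point) (f g : K), f ≠ 0 → g ≠ 0 → v p (f * g) = v p f + v p g
  v_add : ∀ (p : Point) (f g : K), f ≠ 0 → g ≠ 0 → f + g ≠ 0 → min (v p f) (v p g) ≤ v p (f + g)
  v_one : ∀ p : Point, v p (1 : K) = 0
  v_algebraMap : ∀ (p : Point) (c : k), c ≠ 0 → v p (algebraMap k K c) = 0
  exists_uniformizer : ∀ p : Point, ∃ f : K, f ≠ 0 ∧ v p f = 1
  finite_support : ∀ f : K, f ≠ 0 → {p : Point | v p f ≠ 0}.Finite
  sum_v : ∀ f : K, f ≠ 0 → ∑ᶠ p : Point, v p f = 0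
  const_of_nonneg : ∀ f : K, f ≠ 0 → (∀ p : Point, 0 ≤ v p f) → ∃ c : k, algebraMap k K c = f
  riemann_roch : ∀ D : Point →₀ ℤ, 2 * (genus : ℤ) - 2 < D.sum (fun _ d => d) →
    (Module.finrank k
        (Submodule.span k {f : K | f = 0 ∨ ∀ p : Point, -(D p) ≤ v p f}) : ℤ)
      = D.sum (fun _ d => d) + 1 - genus

/-- Axioms for the global derivation `η ↦ η' = dη/dt` on `K` determined by an element
`t` as in Proposition 12 (`dt p` plays the role of `v_𝔭(d_𝔭 t)`). -/
structure IsGoodDerivation (k : Type*) [Field k] [Algebra k K]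
    (v : Point → K → ℤ) (genus : ℕ) (D : K → K) (dt : Point → ℤ) : Prop where
  map_add : ∀ f g : K, D (f + g) = D f + D g
  leibniz : ∀ f g : K, D (f * g) = f * D g + g * D f
  map_const : ∀ c : k, D (algebraMap k K c) = 0
  ker_const : ∀ f : K, D f = 0 → ∃ c : k, algebraMap k K c = f
  v_D_of_vne : ∀ f : K, f ≠ 0 → ∀ p : Point, v p f ≠ 0 →
    D f ≠ 0 ∧ v p (D f) = v p f - 1 - dt p
  v_D_of_veq : ∀ f : K, f ≠ 0 → ∀ p : Point, v p f = 0 → D f ≠ 0 → -(dt p) ≤ v p (D f)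
  sum_dt : ∑ᶠ p : Point, max 0 (dt p) ≤ 3 * (genus : ℤ)

/-- `D_u(F) = Σ_{i∈I_F} ((a_i u^i)' / u^i)·x^i`. -/
noncomputable def Du {n : ℕ} (D : K → K) (u : Fin n → K) (F : MvPolynomial (Fin n) K) :
    MvPolynomial (Fin n) K :=
  ∑ mm ∈ F.support,
    MvPolynomial.monomial mm
      ((D (MvPolynomial.coeff mm F * ∏ j, u j ^ mm j)) / ∏ j, u j ^ mm j)


section Aux

variable {k : Type*} [Field k] [Algebra k K] {v : Point → K → ℤ} {genus : ℕ}

/-- `f = 0` or `n ≤ v_p(f)`. -/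
def Ge (v : Point → K → ℤ) (p : Point) (n : ℤ) (f : K) : Prop := f = 0 ∨ n ≤ v p f

theorem ge_zero (p : Point) (n : ℤ) : Ge v p n (0 : K) := Or.inl rfl

theorem Ge.mono {p : Point} {n m : ℤ} {f : K} (h : Ge v p n f) (hm : m ≤ n) : Ge v p m f :=
  h.imp id (fun h => hm.trans h)

theorem Ge.le {p : Point} {n : ℤ} {f : K} (h : Ge v p n f) (hf : f ≠ 0) : n ≤ v p f :=
  h.resolve_left hf

theorem ge_self (p : Point) (f : K) : Ge v p (v p f) f := Or.inr le_rfl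

namespace IsFunctionField

theorem ge_add (hK : IsFunctionField k v genus) {p : Point} {n : ℤ} {f g : K}
    (hf : Ge v p n f) (hg : Ge v p n g) : Ge v p n (f + g) := by
  by_cases hf0 : f = 0
  · simpa [hf0] using hg
  by_cases hg0 : g = 0
  · simpa [hg0] using hf
  by_cases h : f + g = 0
  · exact Or.inl h
  · exact Or.inr ((le_min (hf.le hf0) (hg.le hg0)).trans (hK.v_add p f g hf0 hg0 h))

theorem ge_mul (hK : IsFunctionField k v genus) {p : Point} {n m : ℤ} {f g : K}
    (hf : Ge v p n f) (hg : Ge v p m g) : Ge v p (n + m) (f * g) := by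
  by_cases hf0 : f = 0
  · simp [hf0, Ge]
  by_cases hg0 : g = 0
  · simp [hg0, Ge]
  right
  rw [hK.v_mul p f g hf0 hg0]
  exact add_le_add (hf.le hf0) (hg.le hg0)

theorem ge_const (hK : IsFunctionField k v genus) (p : Point) (c : k) :
    Ge v p 0 (algebraMap k K c) := by
  by_cases hc : c = 0
  · simp [hc, Ge]
  · exact Or.inr (hK.v_algebraMap p c hc).ge

theorem ge_cmul (hK : IsFunctionField k v genus) {p : Point} {n : ℤ} {f : K} (c : k)
    (hf : Ge v p n f) : Ge v p n (algebraMap k K c * f) := by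
  simpa using hK.ge_mul (hK.ge_const p c) hf

theorem ge_neg (hK : IsFunctionField k v genus) {p : Point} {n : ℤ} {f : K}
    (hf : Ge v p n f) : Ge v p n (-f) := by
  have := hK.ge_cmul (-1) hf
  simpa using this

theorem ge_sub (hK : IsFunctionField k v genus) {p : Point} {n : ℤ} {f g : K}
    (hf : Ge v p n f) (hg : Ge v p n g) : Ge v p n (f - g) := by
  rw [sub_eq_add_neg]; exact hK.ge_add hf (hK.ge_neg hg)

theorem ge_sum (hK : IsFunctionField k v genus) {p : Point} {n : ℤ} {ι : Type*} (s : Finset ι)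
    (f : ι → K) (hf : ∀ i ∈ s, Ge v p n (f i)) : Ge v p n (∑ i ∈ s, f i) := by
  induction s using Finset.induction_on with
  | empty => simp [Ge]
  | insert a s ha ih =>
    rw [Finset.sum_insert ha]
    exact hK.ge_add (hf a (by simp)) (ih fun i hi => hf i (by simp [hi]))

theorem ge_prod (hK : IsFunctionField k v genus) {p : Point} {ι : Type*} (s : Finset ι)
    (n : ι → ℤ) (f : ι → K) (hf : ∀ i ∈ s, Ge v p (n i) (f i)) :
    Ge v p (∑ i ∈ s, n i) (∏ i ∈ s, f i) := by
  induction s using Finset.induction_on with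
  | empty => simp [Ge, hK.v_one]
  | insert a s ha ih =>
    rw [Finset.sum_insert ha, Finset.prod_insert ha]
    exact hK.ge_mul (hf a (by simp)) (ih fun i hi => hf i (by simp [hi]))

theorem v_inv (hK : IsFunctionField k v genus) (p : Point) {f : K} (hf : f ≠ 0) :
    v p f⁻¹ = - v p f := by
  have := hK.v_mul p f f⁻¹ hf (inv_ne_zero hf)
  rw [mul_inv_cancel₀ hf, hK.v_one] at this
  omega

theorem v_div (hK : IsFunctionField k v genus) (p : Point) {f g : K} (hf : f ≠ 0) (hg : g ≠ 0) :
    v p (f / g) = v p f - v p g := by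
  rw [div_eq_mul_inv, hK.v_mul p _ _ hf (inv_ne_zero hg), hK.v_inv p hg]; ring

theorem v_pow (hK : IsFunctionField k v genus) (p : Point) {f : K} (hf : f ≠ 0) (n : ℕ) :
    v p (f ^ n) = n * v p f := by
  induction n with
  | zero => simp [hK.v_one]
  | succ n ih => rw [pow_succ, hK.v_mul p _ _ (pow_ne_zero n hf) hf, ih]; push_cast; ring

theorem v_zpow (hK : IsFunctionField k v genus) (p : Point) {f : K} (hf : f ≠ 0) (n : ℤ) :
    v p (f ^ n) = n * v p f := by
  obtain ⟨m, rfl | rfl⟩ := n.eq_nat_or_neg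
  · simpa using hK.v_pow p hf m
  · rw [zpow_neg, hK.v_inv p (by simpa using pow_ne_zero m hf)]
    have := hK.v_pow p hf m
    simp only [zpow_natCast, this]; ring

theorem v_neg (hK : IsFunctionField k v genus) (p : Point) {f : K} (hf : f ≠ 0) :
    v p (-f) = v p f := by
  have h := hK.v_mul p (algebraMap k K (-1)) f (by simp) hf
  rw [hK.v_algebraMap p (-1) (by simp)] at h
  simpa using h

theorem v_add_eq (hK : IsFunctionField k v genus) {p : Point} {f g : K} (hf : f ≠ 0)
    (hg : Ge v p (v p f + 1) g) : f + g ≠ 0 ∧ v p (f + g) = v p f := by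
  by_cases hg0 : g = 0
  · simp [hg0, hf]
  have hg1 := hg.le hg0
  have hne : f + g ≠ 0 := by
    intro h
    have : g = -f := by linear_combination h
    rw [this, hK.v_neg p hf] at hg1
    omega
  refine ⟨hne, ?_⟩
  have h1 := hK.v_add p f g hf hg0 hne
  have h2 := hK.v_add p (f + g) (-g) hne (neg_ne_zero.2 hg0) (by simpa using hf)
  rw [hK.v_neg p hg0] at h2
  simp only [add_neg_cancel_right] at h2
  omega

theorem ge_pow (hK : IsFunctionField k v genus) {p : Point} {n : ℤ} {f : K}
    (hf : Ge v p n f) (j : ℕ) : Ge v p (j * n) (f ^ j) := by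
  induction j with
  | zero => simp [Ge, hK.v_one]
  | succ j ih =>
    rw [pow_succ]
    exact (hK.ge_mul ih hf).mono (by push_cast; linarith)

theorem ge_div (hK : IsFunctionField k v genus) {p : Point} {n : ℤ} {f g : K}
    (hf : Ge v p n f) (hg : g ≠ 0) : Ge v p (n - v p g) (f / g) := by
  rw [div_eq_mul_inv]
  refine (hK.ge_mul hf (ge_self p g⁻¹)).mono ?_
  rw [hK.v_inv p hg]; omega

theorem sum_finset (hK : IsFunctionField k v genus) {f : K} (hf : f ≠ 0) (P : Finset Point)
    (hP : ∀ p ∉ P, v p f = 0) : ∑ p ∈ P, v p f = 0 := by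
  rw [← hK.sum_v f hf]
  symm
  apply finsum_eq_sum_of_support_subset
  intro p hp
  by_contra h
  exact hp (hP p (by simpa using h))

/-- finite support as a finset -/
theorem exists_supp (hK : IsFunctionField k v genus) {f : K} (hf : f ≠ 0) :
    ∃ P : Finset Point, ∀ p ∉ P, v p f = 0 := by
  refine ⟨(hK.finite_support f hf).toFinset, fun p hp => ?_⟩
  by_contra h
  exact hp (by simpa using h)

theorem exists_supp_fin (hK : IsFunctionField k v genus) {ι : Type*} [Fintype ι] {f : ι → K}
    (hf : ∀ i, f i ≠ 0) :
    ∃ P : Finset Point, ∀ i, ∀ p ∉ P, v p (f i) = 0 := by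
  choose P hP using fun i => hK.exists_supp (hf i)
  exact ⟨Finset.univ.biUnion P, fun i p hp => hP i p fun h => hp (by simp; exact ⟨i, h⟩)⟩

theorem exists_ne_point (hK : IsFunctionField k v genus) (q : Point) : ∃ p, p ≠ q := by
  by_contra! h
  obtain ⟨f, hf, hq⟩ := hK.exists_uniformizer q
  have := hK.sum_finset hf {q} (by intro p hp; simp [h p] at hp)
  simp [hq] at this

/-- The Riemann-Roch space. -/
def LL (hK : IsFunctionField k v genus) (d : Point → ℤ) : Submodule k K where
  carrier := {f | ∀ p, Ge v p (-(d p)) f}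
  zero_mem' := fun p => ge_zero p _
  add_mem' := fun hf hg p => hK.ge_add (hf p) (hg p)
  smul_mem' := fun c f hf p => by rw [Algebra.smul_def]; exact hK.ge_cmul c (hf p)

theorem mem_LL (hK : IsFunctionField k v genus) (d : Point → ℤ) (f : K) :
    f ∈ hK.LL d ↔ ∀ p, Ge v p (-(d p)) f := Iff.rfl

theorem finrank_LL (hK : IsFunctionField k v genus) (P : Finset Point) (d : Point → ℤ)
    (hd : ∀ p ∉ P, d p = 0) (hdeg : 2 * (genus : ℤ) - 1 ≤ ∑ p ∈ P, d p) :
    (Module.finrank k (hK.LL d) : ℤ) = (∑ p ∈ P, d p) + 1 - genus := by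
  let D : Point →₀ ℤ := Finsupp.onFinset P d (fun p hp => by by_contra h; exact hp (hd p h))
  have hD : D.sum (fun _ d => d) = ∑ p ∈ P, d p := by
    apply Finsupp.onFinset_sum; simp
  have h := hK.riemann_roch D (by rw [hD]; omega)
  rw [hD] at h
  rw [← h]
  have : hK.LL d = Submodule.span k {f : K | f = 0 ∨ ∀ p : Point, -(D p) ≤ v p f} := by
    have hs : {f : K | f = 0 ∨ ∀ p : Point, -(D p) ≤ v p f} = (hK.LL d : Set K) := by
      ext f
      simp only [Set.mem_ofPred_eq, SetLike.mem_coe, mem_LL]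
      constructor
      · rintro (h | h) p
        · exact Or.inl h
        · exact Or.inr (h p)
      · intro h
        by_cases hf : f = 0
        · exact Or.inl hf
        · exact Or.inr fun p => (h p).le hf
    rw [hs, Submodule.span_eq]
  rw [this]

/-- codimension one step in Riemann-Roch. -/
theorem rr_step (hK : IsFunctionField k v genus) (P : Finset Point) (d : Point → ℤ)
    (hd : ∀ p ∉ P, d p = 0) (hdeg : 2 * (genus : ℤ) - 1 ≤ ∑ p ∈ P, d p) (q : Point) (hq : q ∈ P) :
    Module.finrank k (hK.LL (Function.update d q (d q + 1))) = Module.finrank k (hK.LL d) + 1 ∧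
    hK.LL d ≤ hK.LL (Function.update d q (d q + 1)) ∧
    Module.Finite k (hK.LL (Function.update d q (d q + 1))) := by
  have hs : ∑ p ∈ P, Function.update d q (d q + 1) p = ∑ p ∈ P, d p + 1 := by
    rw [Finset.sum_update_of_mem hq, ← Finset.add_sum_erase P d hq, Finset.sdiff_singleton_eq_erase]
    ring
  have h1 := hK.finrank_LL P d hd hdeg
  have h2 := hK.finrank_LL P (Function.update d q (d q + 1))
    (fun p hp => by rw [Function.update_of_ne (by rintro rfl; exact hp hq)]; exact hd p hp)
    (by rw [hs]; omega)
  rw [hs] at h2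
  have h3 : Module.finrank k (hK.LL (Function.update d q (d q + 1)))
      = Module.finrank k (hK.LL d) + 1 := by omega
  refine ⟨h3, ?_, Module.finite_of_finrank_pos (by omega)⟩
  intro f hf p
  refine (hf p).mono ?_
  by_cases h : p = q
  · subst h; simp
  · simp [h]

theorem rr_exists (hK : IsFunctionField k v genus) (P : Finset Point) (d : Point → ℤ)
    (hd : ∀ p ∉ P, d p = 0) (hdeg : 2 * (genus : ℤ) - 1 ≤ ∑ p ∈ P, d p) (q : Point) (hq : q ∈ P) :
    ∃ f : K, f ≠ 0 ∧ v q f = -(d q) - 1 ∧ ∀ p, p ≠ q → -(d p) ≤ v p f := by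
  obtain ⟨h1, h2, h3⟩ := hK.rr_step P d hd hdeg q hq
  have : ∃ f ∈ hK.LL (Function.update d q (d q + 1)), f ∉ hK.LL d := by
    by_contra! h
    have : hK.LL d = hK.LL (Function.update d q (d q + 1)) := le_antisymm h2 h
    rw [← this] at h1
    omega
  obtain ⟨f, hf, hf'⟩ := this
  have hf0 : f ≠ 0 := by rintro rfl; exact hf' (Submodule.zero_mem _)
  have hne : ∀ p, p ≠ q → -(d p) ≤ v p f := by
    intro p hp
    have := (hf p).le hf0
    simpa [hp] using this
  refine ⟨f, hf0, ?_, hne⟩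
  have h4 := (hf q).le hf0
  simp only [Function.update_self] at h4
  by_contra h5
  apply hf'
  intro p
  by_cases h : p = q
  · subst h; right; omega
  · exact Or.inr (hne p h)

theorem rr_lin (hK : IsFunctionField k v genus) (P : Finset Point) (d : Point → ℤ)
    (hd : ∀ p ∉ P, d p = 0) (hdeg : 2 * (genus : ℤ) - 1 ≤ ∑ p ∈ P, d p) (q : Point) (hq : q ∈ P)
    (f g : K) (hf : ∀ p, p ≠ q → Ge v p (-(d p)) f) (hfq : Ge v q (-(d q) - 1) f)
    (hg : ∀ p, p ≠ q → Ge v p (-(d p)) g) (hg0 : g ≠ 0) (hgq : v q g = -(d q) - 1) :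
    ∃ c : k, Ge v q (-(d q)) (f - algebraMap k K c * g) := by
  obtain ⟨h1, h2, h3⟩ := hK.rr_step P d hd hdeg q hq
  have mem : ∀ f, (∀ p, p ≠ q → Ge v p (-(d p)) f) → Ge v q (-(d q) - 1) f →
      f ∈ hK.LL (Function.update d q (d q + 1)) := by
    intro f hf hfq p
    by_cases h : p = q
    · subst h; refine hfq.mono ?_; simp
    · simpa [h] using hf p h
  have hfm := mem f hf hfq
  have hgm := mem g hg (Or.inr hgq.ge)
  have hgn : g ∉ hK.LL d := by
    intro h
    have := (h q).le hg0
    omega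
  set L1 := hK.LL (Function.update d q (d q + 1))
  have hle : hK.LL d ⊔ Submodule.span k {g} ≤ L1 :=
    sup_le h2 (by rw [Submodule.span_singleton_le_iff_mem]; exact hgm)
  have hlt : hK.LL d < hK.LL d ⊔ Submodule.span k {g} := by
    refine lt_of_le_of_ne le_sup_left ?_
    intro h
    apply hgn
    rw [h]
    exact Submodule.mem_sup_right (Submodule.mem_span_singleton_self g)
  have hfin : Module.Finite k ↥(hK.LL d ⊔ Submodule.span k {g}) :=
    Submodule.finiteDimensional_of_le hle
  have h5 := Submodule.finrank_lt_finrank_of_lt hlt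
  have h6 := Submodule.finrank_mono hle
  have heq := Submodule.eq_of_le_of_finrank_eq hle (by omega)
  rw [← heq, Submodule.mem_sup] at hfm
  obtain ⟨y, hy, z, hz, hyz⟩ := hfm
  obtain ⟨c, rfl⟩ := Submodule.mem_span_singleton.1 hz
  refine ⟨c, ?_⟩
  rw [← hyz, Algebra.smul_def, add_sub_cancel_right]
  exact hy q

theorem residue (hK : IsFunctionField k v genus) (q : Point) (f g : K) (hg : g ≠ 0)
    (hf : Ge v q (v q g) f) : ∃ c : k, Ge v q (v q g + 1) (f - algebraMap k K c * g) := by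
  by_cases hf0 : f = 0
  · exact ⟨0, by simp [hf0, Ge]⟩
  obtain ⟨q', hq'⟩ := hK.exists_ne_point q
  obtain ⟨P1, hP1⟩ := hK.exists_supp hf0
  obtain ⟨P2, hP2⟩ := hK.exists_supp hg
  let P := insert q (insert q' (P1 ∪ P2))
  let d0 : Point → ℤ := fun p => if p = q then - v q g - 1 else |v p f| + |v p g|
  let N : ℤ := |2 * genus - 1 - ∑ p ∈ P, d0 p|
  let d : Point → ℤ := fun p => d0 p + if p = q' then N else 0
  have hdq : d q = - v q g - 1 := by simp [d, d0, hq'.symm]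
  have hdp : ∀ p, p ≠ q → |v p f| + |v p g| ≤ d p := by
    intro p hp
    simp only [d, d0, hp, if_false]
    split_ifs
    · have := abs_nonneg (2 * genus - 1 - ∑ p ∈ P, d0 p); omega
    · omega
  have hq'P : q' ∈ P := by simp [P]
  have hsum : ∑ p ∈ P, d p = ∑ p ∈ P, d0 p + N := by
    simp only [d, Finset.sum_add_distrib]
    rw [Finset.sum_ite_eq' P q' (fun _ => N)]
    simp [hq'P]
  have := hK.rr_lin P d (by
      intro p hp
      simp only [P, Finset.mem_insert, Finset.mem_union, not_or] at hp
      simp [d, d0, hp.1, hp.2.1, hP1 p hp.2.2.1, hP2 p hp.2.2.2])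
    (by rw [hsum]; have := le_abs_self (2 * genus - 1 - ∑ p ∈ P, d0 p); simp only [N]; omega)
    q (by simp [P]) f g
    (fun p hp => Or.inr (by have := hdp p hp; have := neg_abs_le (v p f); have := abs_nonneg (v p g); omega))
    (by rw [hdq]; exact hf.mono (by omega))
    (fun p hp => Or.inr (by have := hdp p hp; have := neg_abs_le (v p g); have := abs_nonneg (v p f); omega))
    hg (by omega)
  obtain ⟨c, hc⟩ := this
  exact ⟨c, hc.mono (by omega)⟩

theorem value (hK : IsFunctionField k v genus) (q : Point) (f : K) (hf : Ge v q 0 f) :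
    ∃ c : k, Ge v q 1 (f - algebraMap k K c) := by
  obtain ⟨c, hc⟩ := hK.residue q f 1 one_ne_zero (by rwa [hK.v_one])
  exact ⟨c, by simpa [hK.v_one] using hc⟩

end IsFunctionField

/-- `f` has no poles outside `o`. -/
def Reg (v : Point → K → ℤ) (o : Point) (f : K) : Prop := ∀ p, p ≠ o → Ge v p 0 f

/-- `t` has exactly one pole, at `o`, of order `m`. -/
structure Par (v : Point → K → ℤ) (o : Point) (t : K) (m : ℕ) : Prop where
  mpos : 0 < m
  ne : t ≠ 0
  vo : v o t = -(m : ℤ)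
  reg : Reg v o t

/-- a basis of the ring of functions regular outside `o`. -/
structure Bas (v : Point → K → ℤ) (o : Point) (m : ℕ) (w : Fin m → K) (n : Fin m → ℕ) : Prop where
  ne : ∀ r, w r ≠ 0
  reg : ∀ r, Reg v o (w r)
  vo : ∀ r, v o (w r) = -(n r : ℤ)
  res : ∀ r, n r % m = r
  le : ∀ (r : Fin m) (b : K), b ≠ 0 → Reg v o b → ∀ N : ℕ, v o b = -(N : ℤ) → N % m = r → n r ≤ N

namespace IsFunctionField

theorem reg_add (hK : IsFunctionField k v genus) {o : Point} {f g : K} (hf : Reg v o f)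
    (hg : Reg v o g) : Reg v o (f + g) := fun p hp => hK.ge_add (hf p hp) (hg p hp)

theorem reg_sub (hK : IsFunctionField k v genus) {o : Point} {f g : K} (hf : Reg v o f)
    (hg : Reg v o g) : Reg v o (f - g) := fun p hp => hK.ge_sub (hf p hp) (hg p hp)

theorem reg_mul (hK : IsFunctionField k v genus) {o : Point} {f g : K} (hf : Reg v o f)
    (hg : Reg v o g) : Reg v o (f * g) := fun p hp => by
  simpa using hK.ge_mul (hf p hp) (hg p hp)

theorem reg_const (hK : IsFunctionField k v genus) (o : Point) (c : k) :
    Reg v o (algebraMap k K c) := fun p _ => hK.ge_const p c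

theorem reg_pow (hK : IsFunctionField k v genus) {o : Point} {f : K} (hf : Reg v o f) (j : ℕ) :
    Reg v o (f ^ j) := fun p hp => by
  simpa using hK.ge_pow (hf p hp) j

theorem reg_sum (hK : IsFunctionField k v genus) {o : Point} {ι : Type*} (s : Finset ι) (f : ι → K)
    (hf : ∀ i ∈ s, Reg v o (f i)) : Reg v o (∑ i ∈ s, f i) :=
  fun p hp => hK.ge_sum s f fun i hi => hf i hi p hp

theorem ge_aeval (hK : IsFunctionField k v genus) {p : Point} {t : K} (ht : Ge v p 0 t)
    (P : Polynomial k) : Ge v p 0 (Polynomial.aeval t P) := by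
  rw [Polynomial.aeval_eq_sum_range]
  refine hK.ge_sum _ _ fun i _ => ?_
  rw [Algebra.smul_def]
  exact hK.ge_cmul _ (by simpa using hK.ge_pow ht i)

theorem reg_aeval (hK : IsFunctionField k v genus) {o : Point} {t : K} (ht : Reg v o t)
    (P : Polynomial k) : Reg v o (Polynomial.aeval t P) :=
  fun p hp => hK.ge_aeval (ht p hp) P

theorem reg_nonpos (hK : IsFunctionField k v genus) {o : Point} {f : K} (hf : Reg v o f)
    (hf0 : f ≠ 0) : v o f ≤ 0 := by
  obtain ⟨P, hP⟩ := hK.exists_supp hf0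
  have h := hK.sum_finset hf0 (insert o P) (fun p hp => hP p fun h => hp (by simp [h]))
  rw [← Finset.add_sum_erase _ _ (Finset.mem_insert_self o P)] at h
  have : 0 ≤ ∑ p ∈ (insert o P).erase o, v p f :=
    Finset.sum_nonneg fun p hp => (hf p (Finset.ne_of_mem_erase hp)).le hf0
  omega

theorem exists_reg_pole (hK : IsFunctionField k v genus) (o : Point) (N : ℕ) (hN : 2 * genus ≤ N) :
    ∃ b : K, b ≠ 0 ∧ Reg v o b ∧ v o b = -(N : ℤ) := by
  obtain ⟨b, h0, h1, h2⟩ := hK.rr_exists {o} (fun p => if p = o then (N : ℤ) - 1 else 0)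
    (by intro p hp; have hp' : p ≠ o := by simpa using hp
        simp [hp']) (by simp; omega) o (by simp)
  refine ⟨b, h0, fun p hp => Or.inr (by simpa [hp] using h2 p hp), by rw [h1]; simp⟩

theorem exists_par (hK : IsFunctionField k v genus) (o : Point) :
    ∃ (t : K) (m : ℕ), Par v o t m := by
  obtain ⟨b, h0, h1, h2⟩ := hK.exists_reg_pole o (2 * genus + 1) (by omega)
  exact ⟨b, 2 * genus + 1, by omega, h0, h2, h1⟩

theorem exists_bas (hK : IsFunctionField k v genus) (o : Point) (m : ℕ) (hm : 0 < m) :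
    ∃ (w : Fin m → K) (n : Fin m → ℕ), Bas v o m w n := by
  have key : ∀ r : Fin m, ∃ n : ℕ, ∃ w : K, w ≠ 0 ∧ Reg v o w ∧ v o w = -(n : ℤ) ∧ n % m = r ∧
      ∀ (b : K), b ≠ 0 → Reg v o b → ∀ N : ℕ, v o b = -(N : ℤ) → N % m = r → n ≤ N := by
    intro r
    have hex : ∃ n : ℕ, n % m = r ∧ ∃ w : K, w ≠ 0 ∧ Reg v o w ∧ v o w = -(n : ℤ) := by
      refine ⟨r + m * (2 * genus), by simp [Nat.mod_eq_of_lt r.2], ?_⟩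
      obtain ⟨b, h⟩ := hK.exists_reg_pole o (r + m * (2 * genus)) (by nlinarith)
      exact ⟨b, h⟩
    obtain ⟨h1, w, h2, h3, h4⟩ := Nat.find_spec hex
    refine ⟨Nat.find hex, w, h2, h3, h4, h1, fun b hb hb' N hN hNr => ?_⟩
    exact Nat.find_min' hex ⟨hNr, b, hb, hb', hN⟩
  choose n w h1 h2 h3 h4 h5 using key
  exact ⟨w, n, h1, h2, h3, h4, h5⟩

theorem v_aeval (hK : IsFunctionField k v genus) {o : Point} {t : K} {m : ℕ} (ht : Par v o t m)
    {P : Polynomial k} (hP : P ≠ 0) :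
    Polynomial.aeval t P ≠ 0 ∧ v o (Polynomial.aeval t P) = -(m * P.natDegree : ℤ) := by
  have hb : ∀ (Q : Polynomial k) (j : ℕ), (∀ i, j ≤ i → Q.coeff i = 0) →
      Ge v o (-(m * j : ℤ) + m) (Polynomial.aeval t Q) := by
    intro Q j hj
    rw [Polynomial.aeval_eq_sum_range]
    refine hK.ge_sum _ _ fun i _ => ?_
    rw [Algebra.smul_def]
    by_cases hij : j ≤ i
    · simp [hj i hij, Ge]
    · refine hK.ge_cmul _ (Or.inr ?_)
      rw [hK.v_pow o ht.ne, ht.vo]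
      have : (i : ℤ) + 1 ≤ j := by omega
      have hm : (0 : ℤ) ≤ m := by positivity
      nlinarith
  have hlead : algebraMap k K P.leadingCoeff ≠ 0 := by simpa using hP
  have h1 : algebraMap k K P.leadingCoeff * t ^ P.natDegree ≠ 0 :=
    mul_ne_zero hlead (pow_ne_zero _ ht.ne)
  have h2 : v o (algebraMap k K P.leadingCoeff * t ^ P.natDegree) = -(m * P.natDegree : ℤ) := by
    rw [hK.v_mul o _ _ hlead (pow_ne_zero _ ht.ne), hK.v_pow o ht.ne, ht.vo,
      hK.v_algebraMap o _ (by simpa using hP)]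
    ring
  have h3 := hb P.eraseLead P.natDegree (by
    intro i hi
    rw [Polynomial.eraseLead_coeff]
    split_ifs with h
    · rfl
    · exact Polynomial.coeff_eq_zero_of_natDegree_lt (by omega))
  have h4 : Polynomial.aeval t P = algebraMap k K P.leadingCoeff * t ^ P.natDegree
      + Polynomial.aeval t P.eraseLead := by
    have h5 := congrArg (Polynomial.aeval t) P.eraseLead_add_C_mul_X_pow
    rw [← h5, map_add]
    simp [add_comm]
  rw [h4, ← h2]
  refine hK.v_add_eq h1 (h3.mono ?_)
  rw [h2]
  have := ht.mpos
  omega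

theorem sum_distinct (hK : IsFunctionField k v genus) (o : Point) {ι : Type*} (s : Finset ι)
    (f : ι → K) (h0 : ∀ i ∈ s, f i ≠ 0)
    (hinj : ∀ i ∈ s, ∀ j ∈ s, v o (f i) = v o (f j) → i = j) (hs : s.Nonempty) :
    ∑ i ∈ s, f i ≠ 0 ∧ ∃ i ∈ s, v o (∑ i ∈ s, f i) = v o (f i) ∧ ∀ j ∈ s, v o (f i) ≤ v o (f j) := by
  obtain ⟨i, hi, hmin⟩ := Finset.exists_min_image s (fun i => v o (f i)) hs
  rw [← Finset.add_sum_erase _ _ hi]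
  have := hK.v_add_eq (p := o) (h0 i hi) (g := ∑ j ∈ s.erase i, f j) (by
    refine hK.ge_sum _ _ fun j hj => Or.inr ?_
    have hj' := Finset.mem_of_mem_erase hj
    have h1 := hmin j hj'
    have h2 : v o (f i) ≠ v o (f j) := fun h => Finset.ne_of_mem_erase hj (hinj i hi j hj' h).symm
    omega)
  exact ⟨this.1, i, hi, this.2, hmin⟩

theorem coord_bound (hK : IsFunctionField k v genus) {o : Point} {t : K} {m : ℕ}
    (ht : Par v o t m) {w : Fin m → K} {n : Fin m → ℕ} (hw : Bas v o m w n)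
    (c : Fin m → Polynomial k) (B : ℤ) (hB : Ge v o (-B) (∑ r, Polynomial.aeval t (c r) * w r))
    (r : Fin m) (hr : c r ≠ 0) :
    (∑ r, Polynomial.aeval t (c r) * w r) ≠ 0 ∧ (m : ℤ) * (c r).natDegree + n r ≤ B := by
  let s : Finset (Fin m) := Finset.univ.filter fun r => c r ≠ 0
  have hs : ∑ r, Polynomial.aeval t (c r) * w r = ∑ r ∈ s, Polynomial.aeval t (c r) * w r := by
    symm
    apply Finset.sum_subset (Finset.subset_univ _)
    intro r _ hr
    have : c r = 0 := by simpa [s] using hr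
    simp [this]
  have hv : ∀ r ∈ s, Polynomial.aeval t (c r) * w r ≠ 0 ∧
      v o (Polynomial.aeval t (c r) * w r) = -((m : ℤ) * (c r).natDegree + n r) := by
    intro r hr
    have hcr : c r ≠ 0 := by simpa [s] using hr
    obtain ⟨h1, h2⟩ := hK.v_aeval ht hcr
    refine ⟨mul_ne_zero h1 (hw.ne r), ?_⟩
    rw [hK.v_mul o _ _ h1 (hw.ne r), h2, hw.vo]; ring
  have hrs : r ∈ s := by simp [s, hr]
  obtain ⟨h1, i, hi, h2, h3⟩ := hK.sum_distinct o s _ (fun r hr => (hv r hr).1) (by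
    intro i hi j hj hij
    rw [(hv i hi).2, (hv j hj).2] at hij
    have h4 : m * (c i).natDegree + n i = m * (c j).natDegree + n j := by
      zify; omega
    have h5 := congrArg (· % m) h4
    simp only [Nat.mul_add_mod] at h5
    rw [hw.res, hw.res] at h5
    exact Fin.ext h5) ⟨r, hrs⟩
  rw [hs] at hB ⊢
  refine ⟨h1, ?_⟩
  have h4 := hB.le h1
  have h5 := h3 r hrs
  rw [(hv r hrs).2] at h5
  omega

theorem coord_zero (hK : IsFunctionField k v genus) {o : Point} {t : K} {m : ℕ}
    (ht : Par v o t m) {w : Fin m → K} {n : Fin m → ℕ} (hw : Bas v o m w n)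
    (c : Fin m → Polynomial k) (h : ∑ r, Polynomial.aeval t (c r) * w r = 0) : c = 0 := by
  funext r
  by_contra hr
  exact (hK.coord_bound ht hw c 0 (Or.inl h) r hr).1 h

theorem coord_exists (hK : IsFunctionField k v genus) {o : Point} {t : K} {m : ℕ}
    (ht : Par v o t m) {w : Fin m → K} {n : Fin m → ℕ} (hw : Bas v o m w n)
    (b : K) (hb : Reg v o b) :
    ∃ c : Fin m → Polynomial k, b = ∑ r, Polynomial.aeval t (c r) * w r := by
  suffices H : ∀ N : ℕ, ∀ b : K, Reg v o b → Ge v o (-(N : ℤ) + 1) b →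
      ∃ c : Fin m → Polynomial k, b = ∑ r, Polynomial.aeval t (c r) * w r by
    refine H ((- v o b).toNat + 1) b hb (Or.inr ?_)
    have := Int.self_le_toNat (- v o b)
    push_cast; omega
  intro N
  induction N with
  | zero =>
    intro b hb hN
    by_cases hb0 : b = 0
    · exact ⟨0, by simp [hb0]⟩
    · have := hN.le hb0
      have := hK.reg_nonpos hb hb0
      simp at *; omega
  | succ N ih =>
    intro b hb hN
    by_cases hb0 : b = 0
    · exact ⟨0, by simp [hb0]⟩
    have h1 := hN.le hb0
    by_cases h2 : -(N : ℤ) + 1 ≤ v o b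
    · exact ih b hb (Or.inr h2)
    have h3 : v o b = -(N : ℤ) := by push_cast at h1; omega
    let r : Fin m := ⟨N % m, Nat.mod_lt _ ht.mpos⟩
    have hle := hw.le r b hb0 hb N h3 rfl
    have hmod : n r % m = N % m := hw.res r
    obtain ⟨j, hj⟩ : ∃ j, N = n r + m * j := by
      obtain ⟨j, hj⟩ := (Nat.modEq_iff_dvd' hle).1 hmod
      exact ⟨j, by omega⟩
    have hg0 : t ^ j * w r ≠ 0 := mul_ne_zero (pow_ne_zero _ ht.ne) (hw.ne r)
    have hgv : v o (t ^ j * w r) = -(N : ℤ) := by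
      rw [hK.v_mul o _ _ (pow_ne_zero _ ht.ne) (hw.ne r), hK.v_pow o ht.ne, ht.vo, hw.vo, hj]
      push_cast; ring
    obtain ⟨c, hc⟩ := hK.residue o b (t ^ j * w r) hg0 (Or.inr (by rw [hgv, h3]))
    rw [hgv] at hc
    obtain ⟨c', hc'⟩ := ih _ (hK.reg_sub hb (hK.reg_mul (hK.reg_const o c)
      (hK.reg_mul (hK.reg_pow ht.reg j) (hw.reg r)))) hc
    refine ⟨c' + Pi.single r (Polynomial.C c * Polynomial.X ^ j), ?_⟩
    have : ∑ s, Polynomial.aeval t ((Pi.single r (Polynomial.C c * Polynomial.X ^ j) :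
        Fin m → Polynomial k) s) * w s = algebraMap k K c * (t ^ j * w r) := by
      rw [Finset.sum_eq_single r]
      · simp [mul_assoc]
      · intro s _ hs; simp [Pi.single_eq_of_ne hs]
      · simp
    simp only [Pi.add_apply, map_add, add_mul, Finset.sum_add_distrib, this, ← hc']
    ring

end IsFunctionField

/-- `M` is the matrix of multiplication by `b` in the basis `w`. -/
def IsMat {m : ℕ} (t : K) (w : Fin m → K) (b : K) (M : Matrix (Fin m) (Fin m) (Polynomial k)) :
    Prop := ∀ r, b * w r = ∑ s, Polynomial.aeval t (M r s) * w s

theorem IsMat.mul {m : ℕ} {t : K} {w : Fin m → K} {b b' : K}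
    {M M' : Matrix (Fin m) (Fin m) (Polynomial k)} (h : IsMat t w b M) (h' : IsMat t w b' M') :
    IsMat t w (b * b') (M * M') := by
  intro r
  calc b * b' * w r = b' * (b * w r) := by ring
    _ = ∑ u, Polynomial.aeval t (M r u) * (b' * w u) := by
        rw [h r, Finset.mul_sum]; exact Finset.sum_congr rfl fun u _ => by ring
    _ = ∑ u, ∑ s, Polynomial.aeval t (M r u) * Polynomial.aeval t (M' u s) * w s := by
        refine Finset.sum_congr rfl fun u _ => ?_
        rw [h' u, Finset.mul_sum]; exact Finset.sum_congr rfl fun s _ => by ring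
    _ = _ := by
        rw [Finset.sum_comm]
        refine Finset.sum_congr rfl fun s _ => ?_
        rw [Matrix.mul_apply, map_sum, Finset.sum_mul]
        simp

theorem IsMat.one {m : ℕ} {t : K} {w : Fin m → K} :
    IsMat t w 1 (1 : Matrix (Fin m) (Fin m) (Polynomial k)) := by
  intro r
  rw [Finset.sum_eq_single r]
  · simp
  · intro s _ hs; simp [Matrix.one_apply_ne hs.symm]
  · simp

theorem IsMat.pow {m : ℕ} {t : K} {w : Fin m → K} {b : K}
    {M : Matrix (Fin m) (Fin m) (Polynomial k)} (h : IsMat t w b M) (j : ℕ) :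
    IsMat t w (b ^ j) (M ^ j) := by
  induction j with
  | zero => simpa using IsMat.one
  | succ j ih => rw [pow_succ, pow_succ]; exact ih.mul h

theorem IsMat.add {m : ℕ} {t : K} {w : Fin m → K} {b b' : K}
    {M M' : Matrix (Fin m) (Fin m) (Polynomial k)} (h : IsMat t w b M) (h' : IsMat t w b' M') :
    IsMat t w (b + b') (M + M') := by
  intro r
  simp [add_mul, Finset.sum_add_distrib, h r, h' r]

theorem IsMat.smul {m : ℕ} {t : K} {w : Fin m → K} {b : K}
    {M : Matrix (Fin m) (Fin m) (Polynomial k)} (h : IsMat t w b M) (P : Polynomial k) :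
    IsMat t w (Polynomial.aeval t P * b) (P • M) := by
  intro r
  rw [mul_assoc, h r, Finset.mul_sum]
  simp [mul_assoc]

namespace IsFunctionField

theorem isMat_unique (hK : IsFunctionField k v genus) {o : Point} {t : K} {m : ℕ}
    (ht : Par v o t m) {w : Fin m → K} {n : Fin m → ℕ} (hw : Bas v o m w n) {b : K}
    {M M' : Matrix (Fin m) (Fin m) (Polynomial k)} (h : IsMat t w b M) (h' : IsMat t w b M') :
    M = M' := by
  funext r
  have := hK.coord_zero ht hw (fun s => M r s - M' r s) (by
    simp only [map_sub, sub_mul, Finset.sum_sub_distrib]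
    rw [← h r, ← h' r, sub_self])
  funext s
  exact sub_eq_zero.1 (congrFun this s)

theorem isMat_exists (hK : IsFunctionField k v genus) {o : Point} {t : K} {m : ℕ}
    (ht : Par v o t m) {w : Fin m → K} {n : Fin m → ℕ} (hw : Bas v o m w n) {b : K}
    (hb : Reg v o b) : ∃ M : Matrix (Fin m) (Fin m) (Polynomial k), IsMat t w b M := by
  choose M hM using fun r => hK.coord_exists ht hw (b * w r) (hK.reg_mul hb (hw.reg r))
  exact ⟨M, hM⟩

theorem sub_const_ne (hK : IsFunctionField k v genus) {o : Point} {t : K} {m : ℕ}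
    (ht : Par v o t m) (a : k) : t - algebraMap k K a ≠ 0 ∧ Reg v o (t - algebraMap k K a) := by
  refine ⟨?_, hK.reg_sub ht.reg (hK.reg_const o a)⟩
  have := (hK.v_aeval ht (Polynomial.X_sub_C_ne_zero a)).1
  simpa using this

theorem trace_root (hK : IsFunctionField k v genus) {o : Point} {t : K} {m : ℕ}
    (ht : Par v o t m) {w : Fin m → K} {n : Fin m → ℕ} (hw : Bas v o m w n) {b : K}
    (hb : Reg v o b) (a : k) (hab : ∀ q, q ≠ o → Ge v q 1 (t - algebraMap k K a) → Ge v q 1 b)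
    {M : Matrix (Fin m) (Fin m) (Polynomial k)} (hM : IsMat t w b M) : M.trace.eval a = 0 := by
  obtain ⟨hs0, hsr⟩ := hK.sub_const_ne ht a
  obtain ⟨P, hP⟩ := hK.exists_supp hs0
  let E : ℕ := ∑ q ∈ P, (v q (t - algebraMap k K a)).toNat
  have hreg : Reg v o (b ^ E / (t - algebraMap k K a)) := by
    intro q hq
    by_cases h : Ge v q 1 (t - algebraMap k K a)
    · refine (hK.ge_div (hK.ge_pow (hab q hq h) E) hs0).mono ?_
      have h1 := h.le hs0
      have hqP : q ∈ P := by
        by_contra hqP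
        rw [hP q hqP] at h1
        omega
      have : (v q (t - algebraMap k K a)).toNat ≤ E :=
        Finset.single_le_sum (f := fun q => (v q (t - algebraMap k K a)).toNat)
          (fun _ _ => Nat.zero_le _) hqP
      omega
    · have h1 := (hsr q hq).le hs0
      have h2 : v q (t - algebraMap k K a) = 0 := by
        by_contra h3
        exact h (Or.inr (by omega))
      have := hK.ge_div (hK.reg_pow hb E q hq) hs0
      rwa [h2, sub_zero] at this
  obtain ⟨M', hM'⟩ := hK.isMat_exists ht hw hreg
  have h1 := hM'.smul (Polynomial.X - Polynomial.C a)
  have h2 : Polynomial.aeval t (Polynomial.X - Polynomial.C a) *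
      (b ^ E / (t - algebraMap k K a)) = b ^ E := by
    simp only [map_sub, Polynomial.aeval_X, Polynomial.aeval_C]
    field_simp
  rw [h2] at h1
  have h3 := hK.isMat_unique ht hw (hM.pow E) h1
  let φ := (Polynomial.evalRingHom a).mapMatrix (m := Fin m)
  have h4 : (φ M) ^ E = 0 := by
    rw [← map_pow, h3]
    ext i j
    simp [φ]
  have h5 : IsNilpotent (φ M).trace := Matrix.isNilpotent_trace_of_isNilpotent ⟨E, h4⟩
  have h6 := h5.eq_zero
  rw [← h6]
  simp [Matrix.trace, φ, Polynomial.eval_finsetSum]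

theorem trace_contra [CharZero k] (hK : IsFunctionField k v genus) {o : Point} {t : K} {m : ℕ}
    (ht : Par v o t m) {w : Fin m → K} {n : Fin m → ℕ} (hw : Bas v o m w n) {b : K}
    (hb : Reg v o b) (hb0 : b ≠ 0) (A : Finset k) (e : ℕ) (hA : A.card = e + 1)
    (hab : ∀ a ∈ A, ∀ q, q ≠ o → Ge v q 1 (t - algebraMap k K a) → Ge v q 1 b)
    (hv : v o b = -(m * e : ℤ)) : False := by
  have ht0 : t ^ e ≠ 0 := pow_ne_zero _ ht.ne
  have hte : v o (t ^ e) = -(m * e : ℤ) := by rw [hK.v_pow o ht.ne, ht.vo]; ring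
  obtain ⟨c, hc⟩ := hK.residue o b (t ^ e) ht0 (Or.inr (by rw [hte, hv]))
  have hc0 : c ≠ 0 := by
    rintro rfl
    have := (hc.mono le_rfl).le (by simpa using hb0)
    simp only [map_zero, zero_mul, sub_zero] at this
    omega
  rw [hte] at hc
  set b' := b - algebraMap k K c * t ^ e with hb'
  have hreg : Reg v o b' := hK.reg_sub hb (hK.reg_mul (hK.reg_const o c) (hK.reg_pow ht.reg e))
  obtain ⟨M', hM'⟩ := hK.isMat_exists ht hw hreg
  have hM := (IsMat.one (k := k) (t := t) (w := w)).smul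
    (Polynomial.C c * Polynomial.X ^ e) |>.add hM'
  have hbb : Polynomial.aeval t (Polynomial.C c * Polynomial.X ^ e) * 1 + b' = b := by
    simp [hb']
  rw [hbb] at hM
  have hdiag : ∀ r, (M' r r).degree < e := by
    intro r
    by_cases h : M' r r = 0
    · rw [h, Polynomial.degree_zero]; exact WithBot.bot_lt_coe _
    have h1 := hK.coord_bound ht hw (M' r) (m * e - 1 + n r) (by
      rw [← hM' r]
      refine (hK.ge_mul hc (ge_self o (w r))).mono ?_
      rw [hw.vo]; omega) r h
    rw [Polynomial.degree_lt_iff_coeff_zero] 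
    intro i hi
    apply Polynomial.coeff_eq_zero_of_natDegree_lt
    have h2 := h1.2
    by_contra h3
    have h4 : (e : ℤ) ≤ (M' r r).natDegree := by omega
    have h5 : (m : ℤ) * e ≤ m * (M' r r).natDegree := by
      exact mul_le_mul_of_nonneg_left h4 (by positivity)
    omega
  have hdeg : M'.trace.degree < e := by
    rw [Polynomial.degree_lt_iff_coeff_zero]
    intro i hi
    rw [Matrix.trace, Polynomial.finsetSum_coeff]
    refine Finset.sum_eq_zero fun r _ => ?_
    exact (Polynomial.degree_lt_iff_coeff_zero _ _).1 (hdiag r) i hi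
  set M := (Polynomial.C c * Polynomial.X ^ e) • (1 : Matrix (Fin m) (Fin m) (Polynomial k)) + M'
  have htr : M.trace = Polynomial.C (c * m) * Polynomial.X ^ e + M'.trace := by
    simp only [M, Matrix.trace_add, Matrix.trace_smul, Matrix.trace_one, Fintype.card_fin,
      smul_eq_mul, map_mul, map_natCast]
    ring
  have hcoef : M.trace.coeff e = c * m := by
    rw [htr, Polynomial.coeff_add, (Polynomial.degree_lt_iff_coeff_zero _ _).1 hdeg e le_rfl]
    rw [Polynomial.coeff_C_mul, Polynomial.coeff_X_pow_self]; ring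
  have hm0 : (m : k) ≠ 0 := by
    have := ht.mpos
    exact_mod_cast this.ne'
  have hnd : M.trace.natDegree < A.card := by
    rw [hA, Nat.lt_succ_iff, Polynomial.natDegree_le_iff_degree_le, htr]
    exact (Polynomial.degree_add_le _ _).trans (max_le (Polynomial.degree_C_mul_X_pow_le e _) hdeg.le)
  have := Polynomial.eq_zero_of_natDegree_lt_card_of_eval_eq_zero' M.trace A
    (fun a ha => hK.trace_root ht hw hb a (hab a ha) hM) hnd
  rw [this] at hcoef
  simp only [Polynomial.coeff_zero] at hcoef
  exact mul_ne_zero hc0 hm0 hcoef.symm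

theorem ram_bound [CharZero k] (hK : IsFunctionField k v genus) {o : Point} {t : K} {m : ℕ}
    (ht : Par v o t m) (P : Finset Point) (hP : o ∉ P) (a : Point → k)
    (ha : ∀ q ∈ P, Ge v q 1 (t - algebraMap k K (a q))) :
    ∑ q ∈ P, (v q (t - algebraMap k K (a q)) - 1) ≤ m + 2 * genus - 1 := by
  have hmpos := ht.mpos
  obtain ⟨w, n, hw⟩ := hK.exists_bas o m ht.mpos
  rcases P.eq_empty_or_nonempty with rfl | hne
  · simp; omega
  let A : Finset k := P.image a
  obtain ⟨e, he⟩ : ∃ e, A.card = e + 1 :=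
    ⟨A.card - 1, by have := (hne.image a).card_pos; simp only [A]; omega⟩
  let G : Polynomial k := ∏ x ∈ A, (Polynomial.X - Polynomial.C x)
  have hG0 : G ≠ 0 := Finset.prod_ne_zero_iff.2 fun x _ => Polynomial.X_sub_C_ne_zero x
  have hGd : G.natDegree = e + 1 := by
    simp only [G]
    rw [Polynomial.natDegree_prod _ _ fun x _ => Polynomial.X_sub_C_ne_zero x]
    simp [he]
  obtain ⟨hF0, hFo⟩ := hK.v_aeval ht hG0
  have hFr := hK.reg_aeval ht.reg G
  set F := Polynomial.aeval t G with hF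
  have hFge : ∀ x ∈ A, ∀ q, q ≠ o → v q (t - algebraMap k K x) ≤ v q F := by
    intro x hx q hq
    have h1 : F = (t - algebraMap k K x) *
        Polynomial.aeval t (∏ y ∈ A.erase x, (Polynomial.X - Polynomial.C y)) := by
      rw [hF]
      simp only [G]
      rw [← Finset.mul_prod_erase A _ hx, map_mul]
      simp
    have h2 : Polynomial.aeval t (∏ y ∈ A.erase x, (Polynomial.X - Polynomial.C y)) ≠ 0 := by
      intro h
      rw [h, mul_zero] at h1
      exact hF0 h1
    rw [h1, hK.v_mul q _ _ (hK.sub_const_ne ht x).1 h2]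
    have := (hK.reg_aeval ht.reg (∏ y ∈ A.erase x, (Polynomial.X - Polynomial.C y)) q hq).le h2
    omega
  obtain ⟨S, hS⟩ := hK.exists_supp hF0
  let Q := (insert o S).erase o |>.filter fun q => 1 ≤ v q F
  have hQmem : ∀ q, q ≠ o → 1 ≤ v q F → q ∈ Q := by
    intro q hq h
    simp only [Q, Finset.mem_filter, Finset.mem_erase, Finset.mem_insert]
    refine ⟨⟨hq, Or.inr ?_⟩, h⟩
    by_contra h'
    rw [hS q h'] at h
    omega
  have hQ1 : ∀ q ∈ Q, q ≠ o ∧ 1 ≤ v q F := by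
    intro q hq
    simp only [Q, Finset.mem_filter, Finset.mem_erase, Finset.mem_insert] at hq
    exact ⟨hq.1.1, hq.2⟩
  have hsum : ∑ q ∈ Q, v q F = m * (e + 1) := by
    have h1 := hK.sum_finset hF0 (insert o S) (fun q hq => hS q fun h => hq (by simp [h]))
    rw [← Finset.add_sum_erase _ _ (Finset.mem_insert_self o S), hFo, hGd] at h1
    have h2 : ∑ q ∈ Q, v q F = ∑ q ∈ (insert o S).erase o, v q F := by
      simp only [Q]
      apply Finset.sum_filter_of_ne
      intro q hq h
      have := (hFr q (Finset.ne_of_mem_erase hq)).le hF0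
      omega
    rw [h2]; push_cast at h1; linarith
  have hcard : (m : ℤ) * e - 2 * genus + 1 ≤ Q.card := by
    by_contra! hlt
    have hoQ : o ∉ Q := fun h => (hQ1 o h).1 rfl
    obtain ⟨b, hb0, hbo, hbp⟩ := hK.rr_exists (insert o Q)
      (fun p => if p = o then (m : ℤ) * e - 1 else if p ∈ Q then -1 else 0)
      (by
        intro p hp
        simp only [Finset.mem_insert, not_or] at hp
        simp [hp.1, hp.2])
      (by
        rw [Finset.sum_insert hoQ]
        have : ∑ x ∈ Q, (if x = o then (m : ℤ) * e - 1 else if x ∈ Q then -1 else 0)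
            = ∑ x ∈ Q, (-1 : ℤ) := Finset.sum_congr rfl fun x hx => by
          simp [hx, (hQ1 x hx).1]
        rw [this]
        simp
        omega) o (by simp)
    refine hK.trace_contra ht hw (b := b) ?_ hb0 A e he ?_ ?_
    · intro p hp
      have := hbp p hp
      simp only [hp, if_false] at this
      right
      split_ifs at this <;> omega
    · intro x hx q hq hge
      have h1 := hge.le (hK.sub_const_ne ht x).1
      have h2 := hQmem q hq (h1.trans (hFge x hx q hq))
      have := hbp q hq
      simp only [hq, h2, if_false, if_true] at this
      exact Or.inr (by omega)
    · rw [hbo]; simp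
  have hPQ : ∀ q ∈ P, q ∈ Q := by
    intro q hq
    have hqo : q ≠ o := fun h => hP (h ▸ hq)
    exact hQmem q hqo (((ha q hq).le (hK.sub_const_ne ht _).1).trans
      (hFge (a q) (Finset.mem_image_of_mem a hq) q hqo))
  calc ∑ q ∈ P, (v q (t - algebraMap k K (a q)) - 1) ≤ ∑ q ∈ P, (v q F - 1) := by
        refine Finset.sum_le_sum fun q hq => ?_
        have hqo : q ≠ o := fun h => hP (h ▸ hq)
        have := hFge (a q) (Finset.mem_image_of_mem a hq) q hqo
        omega
    _ ≤ ∑ q ∈ Q, (v q F - 1) := Finset.sum_le_sum_of_subset_of_nonneg hPQ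
        fun q hq _ => by have := (hQ1 q hq).2; omega
    _ = m * (e + 1) - Q.card := by rw [Finset.sum_sub_distrib, hsum]; simp
    _ ≤ _ := by linarith

end IsFunctionField

theorem exists_derivation_aux (F : Type*) [Field F] [Algebra k F] [CharZero k] [Algebra (Polynomial k) F]
    [IsScalarTower k (Polynomial k) F]
    (hinj : Function.Injective (algebraMap (Polynomial k) F))
    (halg : Algebra.IsAlgebraic (Polynomial k) F) :
    ∃ D : Derivation k F F, D (algebraMap (Polynomial k) F Polynomial.X) = 1 := by
  have : FaithfulSMul (Polynomial k) F := (faithfulSMul_iff_algebraMap_injective _ _).2 hinj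
  let : Algebra (FractionRing (Polynomial k)) F := FractionRing.liftAlgebra (Polynomial k) F
  have : IsScalarTower (Polynomial k) (FractionRing (Polynomial k)) F :=
    FractionRing.isScalarTower_liftAlgebra (Polynomial k) F
  have : CharZero (FractionRing (Polynomial k)) :=
    charZero_of_injective_algebraMap (IsFractionRing.injective (Polynomial k) (FractionRing (Polynomial k)))
  have : Algebra.IsAlgebraic (FractionRing (Polynomial k)) F :=
    (IsFractionRing.comap_isAlgebraic_iff (A := Polynomial k) (K := FractionRing (Polynomial k)) (C := F)).1 halg
  have : Algebra.FormallyEtale (Polynomial k) (FractionRing (Polynomial k)) :=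
    Algebra.FormallyEtale.of_isLocalization (nonZeroDivisors (Polynomial k))
  have : Algebra.FormallyEtale (FractionRing (Polynomial k)) F :=
    Algebra.FormallyEtale.of_isSeparable _ _
  have : Algebra.FormallyEtale (Polynomial k) F :=
    Algebra.FormallyEtale.comp (Polynomial k) (FractionRing (Polynomial k)) F
  let d0 : Derivation k (Polynomial k) F := Polynomial.mkDerivation k (1 : F)
  let φ := (d0.liftKaehlerDifferential).liftBaseChange F
  let ψ := φ.comp (KaehlerDifferential.tensorKaehlerEquivOfFormallyEtale k (Polynomial k) F).symm.toLinearMap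
  refine ⟨ψ.compDer (KaehlerDifferential.D k F), ?_⟩
  simp [ψ, φ, d0, KaehlerDifferential.tensorKaehlerEquivOfFormallyEtale_symm_D_algebraMap]

namespace IsFunctionField

theorem frac (hK : IsFunctionField k v genus) (o q : Point) (hq : q ≠ o) (y : K) (hy : Ge v q 0 y) :
    ∃ h : K, h ≠ 0 ∧ Reg v o h ∧ Reg v o (y * h) ∧ v q h = 0 := by
  by_cases hy0 : y = 0
  · refine ⟨1, one_ne_zero, fun p _ => Or.inr (by rw [hK.v_one]), ?_, hK.v_one q⟩
    intro p _; simp [hy0, Ge]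
  obtain ⟨P1, hP1⟩ := hK.exists_supp hy0
  let P := insert o (insert q P1)
  let d1 : Point → ℤ := fun p => if p = q then -1 else min 0 (v p y)
  let N : ℤ := 2 * genus - 1 - ∑ p ∈ P.erase o, d1 p
  let d : Point → ℤ := Function.update d1 o N
  obtain ⟨h, h0, h1, h2⟩ := hK.rr_exists P d (by
      intro p hp
      have hpo : p ≠ o := fun h => hp (by simp [P, h])
      have hpq : p ≠ q := fun h => hp (by simp [P, h])
      have : v p y = 0 := hP1 p fun h => hp (by simp [P, h])
      simp [d, d1, hpo, hpq, this])
    (by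
      rw [← Finset.add_sum_erase P d (by simp [P] : o ∈ P)]
      have : ∑ p ∈ P.erase o, d p = ∑ p ∈ P.erase o, d1 p :=
        Finset.sum_congr rfl fun p hp => by simp [d, Finset.ne_of_mem_erase hp]
      rw [this]; simp [d, N]) q (by simp [P])
  have hdq : d q = -1 := by simp [d, d1, hq]
  have hvq : v q h = 0 := by rw [h1, hdq]; norm_num
  have hb : ∀ p, p ≠ o → p ≠ q → 0 ≤ v p h ∧ -(v p y) ≤ v p h := by
    intro p hp hpq
    have := h2 p hpq
    simp only [d, d1, Function.update_of_ne hp, if_neg hpq] at this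
    constructor <;> omega
  refine ⟨h, h0, ?_, ?_, hvq⟩
  · intro p hp
    by_cases hpq : p = q
    · subst hpq; exact Or.inr hvq.ge
    · exact Or.inr (hb p hp hpq).1
  · intro p hp
    by_cases hpq : p = q
    · subst hpq; simpa using hK.ge_mul hy (Or.inr hvq.ge)
    · right
      rw [hK.v_mul p y h hy0 h0]
      have := (hb p hp hpq).2
      omega

theorem frac' (hK : IsFunctionField k v genus) (o : Point) (y : K) :
    ∃ h : K, h ≠ 0 ∧ Reg v o h ∧ Reg v o (y * h) := by
  obtain ⟨q, hq⟩ := hK.exists_ne_point o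
  rcases le_total 0 (v q y) with h | h
  · obtain ⟨h, h0, h1, h2, _⟩ := hK.frac o q hq y (Or.inr h)
    exact ⟨h, h0, h1, h2⟩
  · by_cases hy : y = 0
    · refine ⟨1, one_ne_zero, fun p _ => Or.inr (by rw [hK.v_one]), ?_⟩
      intro p _; simp [hy, Ge]
    obtain ⟨h, h0, h1, h2, _⟩ := hK.frac o q hq y⁻¹ (Or.inr (by rw [hK.v_inv q hy]; omega))
    refine ⟨y⁻¹ * h, mul_ne_zero (inv_ne_zero hy) h0, h2, ?_⟩
    rwa [← mul_assoc, mul_inv_cancel₀ hy, one_mul]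

theorem exists_derivation [CharZero k] (hK : IsFunctionField k v genus) {o : Point} {t : K} {m : ℕ}
    (ht : Par v o t m) : ∃ D : Derivation k K K, D t = 1 := by
  let alg : Algebra (Polynomial k) K := (Polynomial.aeval (R := k) t).toAlgebra
  have hal : ∀ P : Polynomial k, algebraMap (Polynomial k) K P = Polynomial.aeval t P := fun P => rfl
  have : IsScalarTower k (Polynomial k) K := IsScalarTower.of_algebraMap_eq (fun c => by
    rw [hal]; simp)
  obtain ⟨w, n, hw⟩ := hK.exists_bas o m ht.mpos
  have hreg : ∀ b : K, Reg v o b → IsAlgebraic (Polynomial k) b := by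
    intro b hb
    refine IsIntegral.isAlgebraic ?_
    refine isIntegral_of_smul_mem_submodule (M := K) (Submodule.span (Polynomial k) (Set.range w)) ?_
      (Submodule.fg_span (Set.finite_range w)) b ?_
    · intro h
      rw [Submodule.span_eq_bot] at h
      exact hw.ne ⟨0, ht.mpos⟩ (h _ ⟨_, rfl⟩)
    · intro x hx
      induction hx using Submodule.span_induction with
      | mem x hx =>
        obtain ⟨r, rfl⟩ := hx
        obtain ⟨c, hc⟩ := hK.coord_exists ht hw (b * w r) (hK.reg_mul hb (hw.reg r))
        rw [smul_eq_mul, hc]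
        refine Submodule.sum_mem _ fun s _ => ?_
        rw [← hal, ← Algebra.smul_def]
        exact Submodule.smul_mem _ _ (Submodule.subset_span ⟨s, rfl⟩)
      | zero => simp
      | add x y _ _ hx hy => rw [smul_add]; exact Submodule.add_mem _ hx hy
      | smul a x _ hx =>
        rw [smul_comm]; exact Submodule.smul_mem _ _ hx
  have hinj : Function.Injective (algebraMap (Polynomial k) K) := by
    rw [injective_iff_map_eq_zero]
    intro P hP
    by_contra h
    exact (hK.v_aeval ht h).1 hP
  obtain ⟨D, hD⟩ := exists_derivation_aux (k := k) K hinj ⟨fun y => by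
    obtain ⟨h, h0, h1, h2⟩ := hK.frac' o y
    have : y = (y * h) * h⁻¹ := by field_simp
    rw [this]
    exact (hreg _ h2).mul (IsAlgebraic.inv_iff.2 (hreg _ h1))⟩
  refine ⟨D, ?_⟩
  rw [hal] at hD
  simpa using hD

end IsFunctionField

/-- A local derivation at `q`. -/
structure LocDer (v : Point → K → ℤ) (q : Point) (L : Derivation k K K) : Prop where
  ge0 : ∀ f, Ge v q 0 f → Ge v q 0 (L f)
  uni : ∃ π : K, π ≠ 0 ∧ v q π = 1 ∧ L π = 1

namespace IsFunctionField

theorem exists_lower (hK : IsFunctionField k v genus) (q : Point) {ι : Type*} [Fintype ι] (f : ι → K) :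
    ∃ C : ℤ, 0 ≤ C ∧ ∀ i, Ge v q (-C) (f i) := by
  refine ⟨∑ i, |v q (f i)|, Finset.sum_nonneg fun _ _ => abs_nonneg _, fun i => Or.inr ?_⟩
  have : |v q (f i)| ≤ ∑ i, |v q (f i)| :=
    Finset.single_le_sum (f := fun i => |v q (f i)|) (fun _ _ => abs_nonneg _) (Finset.mem_univ i)
  have := neg_abs_le (v q (f i))
  omega

theorem cont (hK : IsFunctionField k v genus) {o : Point} {t : K} {m : ℕ}
    (ht : Par v o t m) (D : Derivation k K K) (hD : D t = 1) (q : Point) :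
    ∃ C : ℤ, ∀ g, Ge v q 0 g → Ge v q (-C) (D g) := by
  obtain ⟨w, n, hw⟩ := hK.exists_bas o m ht.mpos
  obtain ⟨C, hC0, hC⟩ := hK.exists_lower q (fun r => D (w r))
  have hDb : ∀ c : Fin m → Polynomial k, D (∑ r, Polynomial.aeval t (c r) * w r) =
      ∑ r, (Polynomial.aeval t (c r) * D (w r) + w r * Polynomial.aeval t (Polynomial.derivative (c r))) := by
    intro c
    rw [map_sum]
    refine Finset.sum_congr rfl fun r _ => ?_
    rw [Derivation.leibniz, Derivation.map_aeval, hD]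
    simp
  have hquot : ∀ y h : K, h ≠ 0 → D y = (D (y * h) - y * D h) / h := by
    intro y h h0
    rw [Derivation.leibniz, smul_eq_mul, smul_eq_mul]
    field_simp
    ring
  refine ⟨C, fun y hy => ?_⟩
  by_cases hqo : q = o
  · subst hqo
    have key : ∀ b e, Reg v q b → Ge v q e b → Ge v q (e - C) (D b) := by
      intro b e hb hbe
      obtain ⟨c, rfl⟩ := hK.coord_exists ht hw b hb
      rw [hDb]
      refine hK.ge_sum _ _ fun r _ => ?_
      by_cases hr : c r = 0
      · simp [hr, Ge]
      have hle := (hK.coord_bound ht hw c (-e) (by rwa [neg_neg]) r hr).2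
      have hv := hK.v_aeval ht hr
      refine hK.ge_add ?_ ?_
      · refine (hK.ge_mul (Or.inr hv.2.ge) (hC r)).mono ?_
        omega
      · by_cases hr' : Polynomial.derivative (c r) = 0
        · simp [hr', Ge]
        have hv' := hK.v_aeval ht hr'
        refine (hK.ge_mul (ge_self q (w r)) (Or.inr hv'.2.ge)).mono ?_
        rw [hw.vo r]
        have hd : ((Polynomial.derivative (c r)).natDegree : ℤ) ≤ (c r).natDegree := by
          have := Polynomial.natDegree_derivative_le (c r)
          omega
        have := mul_le_mul_of_nonneg_left hd (Int.natCast_nonneg m)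
        omega
    obtain ⟨h, h0, h1, h2⟩ := hK.frac' q y
    rw [hquot y h h0]
    have hyh : Ge v q (v q h) (y * h) := by simpa using hK.ge_mul hy (ge_self q h)
    refine (hK.ge_div (n := v q h - C) (hK.ge_sub (key _ _ h2 hyh) ?_) h0).mono (by omega)
    simpa using hK.ge_mul hy (key h _ h1 (ge_self q h))
  · have key : ∀ b, Reg v o b → Ge v q (-C) (D b) := by
      intro b hb
      obtain ⟨c, rfl⟩ := hK.coord_exists ht hw b hb
      rw [hDb]
      refine hK.ge_sum _ _ fun r _ => hK.ge_add ?_ ?_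
      · simpa using hK.ge_mul (hK.ge_aeval (ht.reg q hqo) (c r)) (hC r)
      · exact (hK.ge_mul (hw.reg r q hqo)
          (hK.ge_aeval (ht.reg q hqo) (Polynomial.derivative (c r)))).mono (by omega)
    obtain ⟨h, h0, h1, h2, h3⟩ := hK.frac o q hqo y hy
    rw [hquot y h h0]
    refine (hK.ge_div (n := - C) (hK.ge_sub (key _ h2) ?_) h0).mono (by omega)
    simpa using hK.ge_mul hy (key h h1)

theorem expand (hK : IsFunctionField k v genus) (q : Point) {π : K} (hπ : π ≠ 0) (hv : v q π = 1)
    (g : K) (hg : Ge v q 0 g) (M : ℕ) :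
    ∃ (P : Polynomial k) (g' : K), Ge v q 0 g' ∧ g = Polynomial.aeval π P + π ^ M * g' := by
  induction M with
  | zero => exact ⟨0, g, hg, by simp⟩
  | succ M ih =>
    obtain ⟨P, g', hg', h⟩ := ih
    obtain ⟨c, hc⟩ := hK.value q g' hg'
    refine ⟨P + Polynomial.C c * Polynomial.X ^ M, (g' - algebraMap k K c) / π, ?_, ?_⟩
    · exact (hK.ge_div hc hπ).mono (by omega)
    · rw [h]; simp
      field_simp
      ring

theorem loc_aux (hK : IsFunctionField k v genus) {o : Point} {t : K} {m : ℕ}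
    (ht : Par v o t m) (D : Derivation k K K) (hD : D t = 1) (q : Point) {π : K} (hπ : π ≠ 0)
    (hv : v q π = 1) (e : ℤ) (he : Ge v q e (D π)) (g : K) (hg : Ge v q 0 g) :
    Ge v q e (D g) := by
  obtain ⟨C, hC⟩ := hK.cont ht D hD q
  obtain ⟨P, g', hg', h⟩ := hK.expand q hπ hv g hg ((e + C).toNat + 1)
  have hM := Int.self_le_toNat (e + C)
  set M := (e + C).toNat with hMdef
  have hπ0 : Ge v q 0 π := Or.inr (by omega)
  have h1 : D g = Polynomial.aeval π (Polynomial.derivative P) * D π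
      + (π ^ (M + 1) * D g' + g' * (((M : K) + 1) * (π ^ M * D π))) := by
    rw [h, map_add, Derivation.map_aeval, Derivation.leibniz, Derivation.leibniz_pow]
    simp
  rw [h1]
  have hpow : ∀ j : ℕ, Ge v q 0 (π ^ j) := fun j => by simpa using hK.ge_pow hπ0 j
  refine hK.ge_add ?_ (hK.ge_add ?_ ?_)
  · simpa using hK.ge_mul (hK.ge_aeval hπ0 _) he
  · refine (hK.ge_mul (ge_self q (π ^ (M + 1))) (hC g' hg')).mono ?_
    rw [hK.v_pow q hπ, hv]
    push_cast; omega
  · have hc : Ge v q 0 ((M : K) + 1) := by simpa using hK.ge_const q ((M : k) + 1)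
    have := hK.ge_mul hg' (hK.ge_mul hc (hK.ge_mul (hpow M) he))
    simpa using this

theorem exists_loc (hK : IsFunctionField k v genus) {o : Point} {t : K} {m : ℕ}
    (ht : Par v o t m) (D : Derivation k K K) (hD : D t = 1) (q : Point) :
    ∃ u : K, u ≠ 0 ∧ LocDer v q (u⁻¹ • D) := by
  obtain ⟨π, hπ, hv⟩ := hK.exists_uniformizer q
  have h0 : D π ≠ 0 := by
    intro h0
    have h1 : ∀ g, Ge v q 0 g → D g = 0 := by
      intro g hg
      by_contra h
      have := (hK.loc_aux ht D hD q hπ hv (v q (D g) + 1) (Or.inl h0) g hg).le h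
      omega
    rcases le_total 0 (v q t) with h | h
    · have := h1 t (Or.inr h)
      rw [hD] at this
      exact one_ne_zero this
    · have := h1 t⁻¹ (Or.inr (by rw [hK.v_inv q ht.ne]; omega))
      have h3 : D (t * t⁻¹) = 0 := by rw [mul_inv_cancel₀ ht.ne]; simp
      rw [Derivation.leibniz, this, hD] at h3
      simp [ht.ne] at h3
  refine ⟨D π, h0, ?_, π, hπ, hv, ?_⟩
  · intro f hf
    have := hK.loc_aux ht D hD q hπ hv _ (ge_self q (D π)) f hf
    have := hK.ge_div this h0
    simp only [Derivation.coe_smul, Pi.smul_apply, smul_eq_mul]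
    rw [sub_self, div_eq_inv_mul] at this
    exact this
  · simp [h0]

end IsFunctionField

namespace LocDer

theorem eq (hK : IsFunctionField k v genus) {q : Point} {L : Derivation k K K} {π : K} (hπ : π ≠ 0)
    (hL : L π = 1) (f : K) (e : ℤ) :
    L f = (e : K) * π ^ (e - 1) * (f / π ^ e) + π ^ e * L (f / π ^ e) := by
  have h : f = π ^ e * (f / π ^ e) := by
    have := zpow_ne_zero e hπ
    field_simp
  conv_lhs => rw [h]
  rw [Derivation.leibniz, Derivation.leibniz_zpow, hL]
  simp
  ring

theorem ge (hK : IsFunctionField k v genus) {q : Point} {L : Derivation k K K} (hL : LocDer v q L)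
    {f : K} {e : ℤ} (hf : Ge v q e f) : Ge v q (e - 1) (L f) := by
  obtain ⟨π, hπ, hv, h1⟩ := hL.uni
  have hz := zpow_ne_zero e hπ
  have hvz : ∀ e : ℤ, v q (π ^ e) = e := fun e => by rw [hK.v_zpow q hπ, hv, mul_one]
  have hg : Ge v q 0 (f / π ^ e) := (hK.ge_div hf hz).mono (by rw [hvz]; omega)
  rw [eq hK (q := q) hπ h1 f e]
  refine hK.ge_add ?_ ?_
  · have hc : Ge v q 0 (e : K) := by simpa using hK.ge_const q (e : k)
    have := hK.ge_mul (hK.ge_mul hc (ge_self q (π ^ (e - 1)))) hg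
    rw [hvz] at this
    exact this.mono (by omega)
  · have := hK.ge_mul (ge_self q (π ^ e)) (hL.ge0 _ hg)
    rw [hvz] at this
    exact this.mono (by omega)

theorem veq [CharZero k] (hK : IsFunctionField k v genus) {q : Point} {L : Derivation k K K}
    (hL : LocDer v q L)
    {f : K} (hf : f ≠ 0) (he : v q f ≠ 0) : L f ≠ 0 ∧ v q (L f) = v q f - 1 := by
  obtain ⟨π, hπ, hv, h1⟩ := hL.uni
  set e := v q f with hedef
  have hz := zpow_ne_zero e hπ
  have hvz : ∀ e : ℤ, v q (π ^ e) = e := fun e => by rw [hK.v_zpow q hπ, hv, mul_one]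
  have hg : Ge v q 0 (f / π ^ e) := (hK.ge_div (ge_self q f) hz).mono (by rw [hvz]; omega)
  have hek : (e : k) ≠ 0 := by exact_mod_cast he
  have heK : (e : K) = algebraMap k K e := by simp
  have he0 : (e : K) ≠ 0 := by
    rw [heK]; exact (map_ne_zero (algebraMap k K)).2 hek
  have hA : (e : K) * π ^ (e - 1) * (f / π ^ e) ≠ 0 :=
    mul_ne_zero (mul_ne_zero he0 (zpow_ne_zero _ hπ)) (div_ne_zero hf hz)
  have hvA : v q ((e : K) * π ^ (e - 1) * (f / π ^ e)) = e - 1 := by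
    rw [hK.v_mul q _ _ (mul_ne_zero he0 (zpow_ne_zero _ hπ)) (div_ne_zero hf hz),
      hK.v_mul q _ _ he0 (zpow_ne_zero _ hπ), hK.v_div q hf hz, hvz, hvz, heK,
      hK.v_algebraMap q _ hek]
    omega
  have := hK.v_add_eq (p := q) hA (g := π ^ e * L (f / π ^ e)) (by
    have := hK.ge_mul (ge_self q (π ^ e)) (hL.ge0 _ hg)
    rw [hvz] at this
    exact this.mono (by omega))
  rw [← eq hK (q := q) hπ h1 f e, hvA] at this
  exact this

end LocDer

theorem IsFunctionField.exists_good [CharZero k] (hK : IsFunctionField k v genus) (o : Point) :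
    ∃ (D : Derivation k K K) (u : Point → K), (∀ q, u q ≠ 0 ∧ LocDer v q ((u q)⁻¹ • D)) ∧
      (∀ P : Finset Point, o ∈ P → 2 - 2 * (genus : ℤ) ≤ ∑ q ∈ P, v q (u q)) ∧
      ∀ f, D f = 0 → ∃ c : k, algebraMap k K c = f := by
  obtain ⟨t, m, ht⟩ := hK.exists_par o
  obtain ⟨D, hD⟩ := hK.exists_derivation ht
  choose u hu0 hu using hK.exists_loc ht D hD
  refine ⟨D, u, fun q => ⟨hu0 q, hu q⟩, ?_, ?_⟩
  · intro P hP
    have hval : ∀ q, ∃ a : k, q ≠ o → Ge v q 1 (t - algebraMap k K a) := by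
      intro q
      by_cases hq : q = o
      · exact ⟨0, fun h => absurd hq h⟩
      · obtain ⟨a, ha⟩ := hK.value q t (ht.reg q hq)
        exact ⟨a, fun _ => ha⟩
    choose a ha using hval
    have hram := hK.ram_bound ht (P.erase o) (by simp) a
      (fun q hq => ha q (Finset.ne_of_mem_erase hq))
    rw [← Finset.add_sum_erase P _ hP]
    have ho : v o (u o) = m + 1 := by
      have h := ((hu o).veq hK ht.ne (by rw [ht.vo]; have := ht.mpos; omega)).2
      simp only [Derivation.coe_smul, Pi.smul_apply, smul_eq_mul, hD, mul_one] at h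
      rw [hK.v_inv o (hu0 o), ht.vo] at h
      omega
    have hq : ∀ q ∈ P.erase o, v q (u q) = -(v q (t - algebraMap k K (a q)) - 1) := by
      intro q hq
      have hne : t - algebraMap k K (a q) ≠ 0 := (hK.sub_const_ne ht (a q)).1
      have h1 := (ha q (Finset.ne_of_mem_erase hq)).le hne
      have h := ((hu q).veq hK hne (by omega)).2
      have hD' : D (t - algebraMap k K (a q)) = 1 := by simp [hD]
      simp only [Derivation.coe_smul, Pi.smul_apply, smul_eq_mul, hD', mul_one] at h
      rw [hK.v_inv q (hu0 q)] at h
      omega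
    rw [Finset.sum_congr rfl hq, Finset.sum_neg_distrib, ho]
    omega
  · intro f hf
    by_cases hf0 : f = 0
    · exact ⟨0, by simp [hf0]⟩
    refine hK.const_of_nonneg f hf0 fun q => ?_
    by_contra hq
    have h := ((hu q).veq hK hf0 (by omega)).1
    simp [hf] at h

theorem wron_indep (D : Derivation k K K) (hD : ∀ f, D f = 0 → ∃ c : k, algebraMap k K c = f) :
    ∀ (N : ℕ) (y : Fin N → K), LinearIndependent k y → ∀ c : Fin N → K,
      (∀ i < N, ∑ j, c j * (D^[i]) (y j) = 0) → c = 0 := by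
  intro N
  induction N with
  | zero => intro y _ c _; exact Subsingleton.elim _ _
  | succ N ih =>
    intro y hy c hc
    have hy' : LinearIndependent k (fun j : Fin N => y j.castSucc) :=
      hy.comp Fin.castSucc (Fin.castSucc_injective N)
    by_cases hl : c (Fin.last N) = 0
    · have := ih _ hy' (fun j => c j.castSucc) (fun i hi => by
        have := hc i (by omega)
        rw [Fin.sum_univ_castSucc, hl] at this
        simpa using this)
      funext j
      refine Fin.lastCases hl (fun j => ?_) j
      exact congrFun this j
    · exfalso
      let e : Fin (N + 1) → K := fun j => c j / c (Fin.last N)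
      have hel : e (Fin.last N) = 1 := div_self hl
      have he : ∀ i < N + 1, ∑ j, e j * (D^[i]) (y j) = 0 := by
        intro i hi
        have := hc i hi
        have h2 : ∑ j, e j * (D^[i]) (y j) = (∑ j, c j * (D^[i]) (y j)) / c (Fin.last N) := by
          rw [Finset.sum_div]
          exact Finset.sum_congr rfl fun j _ => by simp only [e]; ring
        rw [h2, this, zero_div]
      have hDe : ∀ i < N, ∑ j : Fin N, D (e j.castSucc) * (D^[i]) (y j.castSucc) = 0 := by
        intro i hi
        have h1 : D (∑ j, e j * (D^[i]) (y j)) = 0 := by rw [he i (by omega), map_zero]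
        have h2 := he (i + 1) (by omega)
        rw [map_sum] at h1
        simp only [Derivation.leibniz, smul_eq_mul] at h1
        rw [Finset.sum_add_distrib] at h1
        simp only [Function.iterate_succ_apply'] at h2
        rw [h2, zero_add, Fin.sum_univ_castSucc, hel] at h1
        simp only [Derivation.map_one_eq_zero, mul_zero, add_zero] at h1
        rw [← h1]
        exact Finset.sum_congr rfl fun j _ => mul_comm _ _
      have h0 := ih _ hy' _ hDe
      have hconst : ∀ j, ∃ a : k, algebraMap k K a = e j := by
        intro j
        refine Fin.lastCases ⟨1, by rw [hel]; simp⟩ (fun j => ?_) j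
        exact hD _ (congrFun h0 j)
      choose a ha using hconst
      have hs := he 0 (by omega)
      have hli := (Fintype.linearIndependent_iff.1 hy) a (by
        rw [← hs]
        refine Finset.sum_congr rfl fun j _ => ?_
        rw [Algebra.smul_def, ha]; rfl) (Fin.last N)
      have := ha (Fin.last N)
      rw [hli, hel] at this
      simp at this

/-- Wronskian-type matrix. -/
noncomputable def WM (D : Derivation k K K) {N : ℕ} (x : Fin (N + 1) → K) :
    Matrix (Fin (N + 1)) (Fin (N + 1)) K :=
  fun i j => if i = Fin.last N then 1 else (D^[(i : ℕ)]) (x j)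

theorem iter_add (D : Derivation k K K) (i : ℕ) {ι : Type*} (s : Finset ι) (f : ι → K) :
    (D^[i]) (∑ j ∈ s, f j) = ∑ j ∈ s, (D^[i]) (f j) := by
  induction i with
  | zero => simp
  | succ i ih => simp only [Function.iterate_succ_apply', ih, map_sum]

theorem iter_zero (D : Derivation k K K) (i : ℕ) : (D^[i]) 0 = 0 := by
  simp

theorem det_WM_ne [CharZero k] (D : Derivation k K K)
    (hD : ∀ f, D f = 0 → ∃ c : k, algebraMap k K c = f)
    {N : ℕ} (x : Fin (N + 1) → K) (hs : ∑ j, x j = 0)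
    (hli : LinearIndependent k (fun j : Fin N => x j.castSucc)) : (WM D x).det ≠ 0 := by
  intro h
  obtain ⟨c, hc0, hc⟩ := Matrix.exists_mulVec_eq_zero_iff.2 h
  have hrow : ∀ i : Fin (N + 1), ∑ j, WM D x i j * c j = 0 := fun i => congrFun hc i
  have h1 := wron_indep D hD N _ hli (fun j => c j.castSucc - c (Fin.last N)) (fun i hi => by
    have h2 := hrow (Fin.castSucc ⟨i, hi⟩)
    have h3 : ∑ j, (D^[i]) (x j) = 0 := by rw [← iter_add, hs, iter_zero]
    simp only [WM, Fin.castSucc_ne_last, if_false] at h2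
    rw [Fin.sum_univ_castSucc] at h2 h3
    simp only [Fin.val_castSucc] at h2
    have h4 : ∑ j : Fin N, (c j.castSucc - c (Fin.last N)) * (D^[i]) (x j.castSucc)
      = (∑ j : Fin N, (D^[i]) (x j.castSucc) * c j.castSucc)
        - c (Fin.last N) * ∑ j : Fin N, (D^[i]) (x j.castSucc) := by
      rw [Finset.mul_sum, ← Finset.sum_sub_distrib]
      exact Finset.sum_congr rfl fun j _ => by ring
    rw [h4]
    linear_combination h2 - c (Fin.last N) * h3)
  have h2 : ∀ j, c j = c (Fin.last N) := by
    intro j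
    refine Fin.lastCases rfl (fun j => ?_) j
    have := congrFun h1 j
    simpa [sub_eq_zero] using this
  have h3 := hrow (Fin.last N)
  simp only [WM, if_true, one_mul] at h3
  rw [Finset.sum_congr rfl fun j _ => h2 j] at h3
  simp only [Finset.sum_const, Finset.card_univ, Fintype.card_fin, nsmul_eq_mul] at h3
  have h4 : ((N + 1 : ℕ) : K) ≠ 0 := by
    have : ((N + 1 : ℕ) : k) ≠ 0 := by exact_mod_cast Nat.succ_ne_zero N
    have h5 := (map_ne_zero (algebraMap k K)).2 this
    rwa [map_natCast] at h5
  have h5 := (mul_eq_zero.1 h3).resolve_left h4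
  exact hc0 (funext fun j => by rw [h2 j, h5]; rfl)

theorem iter_change (L : Derivation k K K) (u : K) (i : ℕ) :
    ∃ c : ℕ → K, (∀ l, i < l → c l = 0) ∧ c i = u ^ i ∧
      ∀ f, ((u • L)^[i]) f = ∑ l ∈ Finset.range (i + 1), c l * (L^[l]) f := by
  induction i with
  | zero =>
    refine ⟨fun l => if l = 0 then 1 else 0, ?_, by simp, by simp⟩
    intro l hl; simp [hl.ne']
  | succ i ih =>
    obtain ⟨c, h1, h2, h3⟩ := ih
    refine ⟨fun l => u * L (c l) + (if l = 0 then 0 else u * c (l - 1)), ?_, ?_, ?_⟩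
    · intro l hl
      simp [h1 l (by omega), h1 (l - 1) (by omega)]
    · simp only [h1 (i + 1) (by omega), Nat.add_sub_cancel, h2]
      simp; ring
    · intro f
      rw [Function.iterate_succ_apply', h3]
      simp only [add_mul, Finset.sum_add_distrib]
      rw [Finset.sum_range_succ (fun l => u * L (c l) * (L^[l]) f), h1 (i + 1) (by omega)]
      rw [Finset.sum_range_succ' (fun l => (if l = 0 then 0 else u * c (l - 1)) * (L^[l]) f)]
      simp only [Derivation.coe_smul, Pi.smul_apply, map_sum, Derivation.leibniz, smul_eq_mul,
        Finset.mul_sum, ← Finset.sum_add_distrib, map_zero, mul_zero, zero_mul, add_zero, if_true,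
        Nat.succ_ne_zero, if_false, Nat.add_sub_cancel, Function.iterate_succ_apply']
      refine Finset.sum_congr rfl fun l _ => ?_
      ring

theorem det_WM_change (L : Derivation k K K) (u : K) {N : ℕ} (x : Fin (N + 1) → K) :
    (WM (u • L) x).det = u ^ (∑ i ∈ Finset.range N, i) * (WM L x).det := by
  choose c h1 h2 h3 using iter_change L u
  let A : Matrix (Fin (N + 1)) (Fin (N + 1)) K := fun i l =>
    if i = Fin.last N then (if l = Fin.last N then 1 else 0) else c i l
  have hA : WM (u • L) x = A * WM L x := by
    ext i j
    rw [Matrix.mul_apply]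
    by_cases hi : i = Fin.last N
    · simp only [WM, A, hi, if_true]
      rw [Fin.sum_univ_castSucc]
      simp
    · have hiN : (i : ℕ) < N := by
        have := Fin.val_lt_last hi
        exact this
      simp only [WM, A, hi, if_false]
      rw [h3]
      rw [Fin.sum_univ_castSucc, h1 i _ (by simpa using hiN), zero_mul, add_zero]
      simp only [Fin.castSucc_ne_last, if_false, Fin.val_castSucc]
      rw [Fin.sum_univ_eq_sum_range (fun l => c i l * (L^[l]) (x j)) N]
      refine Finset.sum_subset (by intro l; simp; omega) fun l _ hl => ?_
      rw [h1 i l (by simpa using hl), zero_mul]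
  have hdA : A.det = u ^ (∑ i ∈ Finset.range N, i) := by
    rw [Matrix.det_of_isLowerTriangular, Fin.prod_univ_castSucc]
    · simp only [A, Fin.castSucc_ne_last, if_false, if_true, mul_one, Fin.val_castSucc, h2]
      rw [Fin.prod_univ_eq_prod_range (fun i => u ^ i) N, Finset.prod_pow_eq_pow_sum]
    · intro i l hil
      have hil' : i < l := hil
      have hi : i ≠ Fin.last N := fun h => by
        rw [h] at hil'
        exact absurd hil' (not_lt.2 (Fin.le_last l))
      simp only [A, hi, if_false]
      exact h1 _ _ hil'
  rw [hA, Matrix.det_mul, hdA]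

theorem local_det (hK : IsFunctionField k v genus) (q : Point) (L : Derivation k K K) {N : ℕ}
    (x : Fin (N + 1) → K) (hs : ∑ j, x j = 0) (e : Fin (N + 1) → ℤ) (δ : ℤ)
    (hL : ∀ (i : ℕ) j, Ge v q (e j - i * δ) ((L^[i]) (x j))) (j0 : Fin (N + 1)) :
    Ge v q (∑ j ∈ Finset.univ.erase j0, e j - δ * (∑ i ∈ Finset.range N, i : ℕ)) (WM L x).det := by
  have h := Matrix.det_updateCol_sum (WM L x) j0 (fun _ => 1)
  rw [one_smul] at h
  rw [← h, Matrix.det_apply]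
  refine hK.ge_sum _ _ fun σ _ => ?_
  have hsign : ∀ (z : K) (n : ℤ), Ge v q n z → Ge v q n (Equiv.Perm.sign σ • z) := by
    intro z n hz
    rcases Int.units_eq_one_or (Equiv.Perm.sign σ) with h | h <;> rw [h]
    · simpa using hz
    · simpa using hK.ge_neg hz
  apply hsign
  set M' := (WM L x).updateCol j0 (fun k ↦ ∑ i, (1 : K) • WM L x k i) with hM'
  have hcol : ∀ i, M' i j0 = if i = Fin.last N then ((N + 1 : ℕ) : K) else 0 := by
    intro i
    rw [hM', Matrix.updateCol_self]
    by_cases hi : i = Fin.last N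
    · simp [WM, hi]
    · simp only [WM, hi, if_false, one_smul]
      rw [← iter_add, hs, iter_zero]
  by_cases hσ : σ j0 = Fin.last N
  · let W : Fin (N + 1) → ℤ := fun j => if j = j0 then 0 else e j - (σ j : ℕ) * δ
    have hW : ∑ j, W j = ∑ j ∈ Finset.univ.erase j0, e j - δ * (∑ i ∈ Finset.range N, i : ℕ) := by
      rw [← Finset.add_sum_erase _ _ (Finset.mem_univ j0)]
      have h1 : ∑ j ∈ Finset.univ.erase j0, W j
          = ∑ j ∈ Finset.univ.erase j0, (e j - (σ j : ℕ) * δ) :=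
        Finset.sum_congr rfl fun j hj => by simp [W, Finset.ne_of_mem_erase hj]
      have h2 : ∑ j, ((σ j : ℕ) : ℤ) = ∑ j : Fin (N + 1), ((j : ℕ) : ℤ) :=
        Equiv.sum_comp σ (fun j : Fin (N + 1) => ((j : ℕ) : ℤ))
      rw [← Finset.add_sum_erase _ _ (Finset.mem_univ j0), hσ, Fin.sum_univ_castSucc] at h2
      simp only [Fin.val_last, Fin.val_castSucc] at h2
      rw [Fin.sum_univ_eq_sum_range (fun i : ℕ => (i : ℤ)) N] at h2
      rw [h1, Finset.sum_sub_distrib, ← Finset.sum_mul]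
      have h3 : ∑ j ∈ Finset.univ.erase j0, ((σ j : ℕ) : ℤ) = ∑ i ∈ Finset.range N, (i : ℤ) := by
        linarith
      rw [h3]
      simp only [W, if_true]
      push_cast
      ring
    rw [← hW]
    refine hK.ge_prod _ _ _ fun j _ => ?_
    by_cases hj : j = j0
    · subst hj
      rw [hcol, if_pos hσ]
      simp only [W, if_true]
      simpa using hK.ge_const q ((N + 1 : ℕ) : k)
    · have hσj : σ j ≠ Fin.last N := fun h => hj (σ.injective (h.trans hσ.symm))
      rw [hM', Matrix.updateCol_ne hj]
      simp only [WM, hσj, if_false, W, hj]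
      exact hL _ j
  · left
    exact Finset.prod_eq_zero (Finset.mem_univ j0) (by rw [hcol, if_neg hσ])

theorem core [CharZero k] (hK : IsFunctionField k v genus) (o : Point) {N : ℕ} (x : Fin (N + 1) → K)
    (hx : ∀ j, x j ≠ 0) (hs : ∑ j, x j = 0)
    (hli : LinearIndependent k (fun j : Fin N => x j.castSucc))
    (S : Finset Point) (hS : ∀ p ∉ S, ∀ j, v p (x j) = 0) (μ : Point → ℤ)
    (hμ : ∀ p ∈ S, ∃ j, v p (x j) ≤ μ p) :
    ∑ p ∈ S, -(μ p) ≤ (∑ i ∈ Finset.range N, i : ℕ) * ((S.card : ℤ) + 2 * genus - 2) := by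
  obtain ⟨D, u, hu, hsum, hD⟩ := hK.exists_good o
  set T : ℕ := ∑ i ∈ Finset.range N, i with hT
  have hW := det_WM_ne D hD x hs hli
  set W := (WM D x).det with hWdef
  obtain ⟨P0, hP0⟩ := hK.exists_supp hW
  let P := insert o (S ∪ P0)
  have h0 := hK.sum_finset hW P (fun p hp => hP0 p fun h => hp (by simp [P, h]))
  have hlow : ∀ q (e : Fin (N + 1) → ℤ) (δ : ℤ),
      (∀ (i : ℕ) j, Ge v q (e j - i * δ) ((((u q)⁻¹ • D)^[i]) (x j))) → ∀ j0,
      T * v q (u q) + ∑ j ∈ Finset.univ.erase j0, e j - δ * T ≤ v q W := by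
    intro q e δ h j0
    have h1 := local_det hK q ((u q)⁻¹ • D) x hs e δ h j0
    have h2 : D = (u q) • ((u q)⁻¹ • D) := by
      rw [smul_smul, mul_inv_cancel₀ (hu q).1, one_smul]
    have h3 : W = (u q) ^ T * (WM ((u q)⁻¹ • D) x).det := by
      rw [hT, ← det_WM_change, ← h2]
    have h4 := hK.ge_mul (ge_self q ((u q) ^ T)) h1
    rw [← h3, hK.v_pow q (hu q).1] at h4
    have := h4.le hW
    linarith
  have hq1 : ∀ q ∈ S, T * v q (u q) + ∑ j, v q (x j) - μ q - T ≤ v q W := by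
    intro q hq
    obtain ⟨j0, hj0⟩ := hμ q hq
    have := hlow q (fun j => v q (x j)) 1 (by
      intro i j
      induction i with
      | zero => simpa using ge_self q (x j)
      | succ i ih =>
        rw [Function.iterate_succ_apply']
        exact ((hu q).2.ge hK ih).mono (by push_cast; linarith)) j0
    rw [← Finset.add_sum_erase _ _ (Finset.mem_univ j0)]
    linarith
  have hq2 : ∀ q ∉ S, T * v q (u q) ≤ v q W := by
    intro q hq
    have := hlow q (fun j => 0) 0 (by
      intro i j
      simp only [mul_zero, sub_zero]
      induction i with
      | zero => exact Or.inr (hS q hq j).ge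
      | succ i ih =>
        rw [Function.iterate_succ_apply']
        exact (hu q).2.ge0 _ ih) 0
    simpa using this
  have hSP : S ⊆ P := fun p hp => by simp [P, hp]
  have hd := hsum P (by simp [P])
  have hx0 : ∑ q ∈ S, ∑ j, v q (x j) = 0 := by
    rw [Finset.sum_comm]
    exact Finset.sum_eq_zero fun j _ => hK.sum_finset (hx j) S fun p hp => hS p hp j
  have e1 : ∑ q ∈ S, (T * v q (u q) + ∑ j, v q (x j) - μ q - T) ≤ ∑ q ∈ S, v q W :=
    Finset.sum_le_sum hq1
  have e2 : ∑ q ∈ P \ S, (T : ℤ) * v q (u q) ≤ ∑ q ∈ P \ S, v q W :=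
    Finset.sum_le_sum fun q hq => hq2 q (Finset.mem_sdiff.1 hq).2
  rw [← Finset.sum_sdiff hSP] at h0 hd
  simp only [Finset.sum_sub_distrib, Finset.sum_add_distrib, hx0, Finset.sum_const, nsmul_eq_mul,
    ← Finset.mul_sum] at e1 e2
  rw [Finset.sum_neg_distrib]
  have hT0 : (0 : ℤ) ≤ T := Int.natCast_nonneg T
  nlinarith [mul_le_mul_of_nonneg_left hd hT0]

theorem bound [CharZero k] (hK : IsFunctionField k v genus) {N : ℕ} (ℓ : ℕ) (b f : Fin (N + 1) → K)
    (hb : ∀ j, b j ≠ 0) (hf : ∀ j, f j ≠ 0) (c : Fin (N + 1) → k) (hc : ∀ j, c j ≠ 0)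
    (hs : ∑ j, c j • (b j * f j ^ ℓ) = 0)
    (hli : LinearIndependent k (fun j : Fin N => b j.castSucc * f j.castSucc ^ ℓ))
    (i0 j0 : Fin (N + 1)) (hnc : ¬ IsConst k (f i0 / f j0))
    (β : Point → ℤ) (hβ : ∀ p j, β p ≤ v p (b j)) (Q : Finset Point) (hQ : ∀ p ∉ Q, β p = 0)
    (H : ℤ) (hH : H = ∑ p ∈ Q, -(β p)) (T : ℕ) (hT : T = ∑ i ∈ Finset.range N, i) :
    0 ≤ H ∧ (ℓ : ℤ) ≤ (N + T * (N + 1)) * H + T * (N + 1) + T * max 0 (2 * (genus : ℤ) - 2) := by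
  have hv0 : ∀ z : K, z ≠ 0 → ¬ IsConst k z → ∃ p, v p z < 0 := by
    intro z hz hz'
    by_contra! h
    exact hz' (hK.const_of_nonneg z hz h)
  obtain ⟨o, ho⟩ := hv0 _ (div_ne_zero (hf i0) (hf j0)) hnc
  obtain ⟨P1, hP1⟩ := hK.exists_supp_fin hb
  obtain ⟨P2, hP2⟩ := hK.exists_supp_fin hf
  let P := Q ∪ (P1 ∪ P2)
  have hPQ : ∀ p ∉ P, β p = 0 := fun p hp => hQ p fun h => hp (by simp [P, h])
  have hPb : ∀ j, ∀ p ∉ P, v p (b j) = 0 := fun j p hp => hP1 j p fun h => hp (by simp [P, h])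
  have hPf : ∀ j, ∀ p ∉ P, v p (f j) = 0 := fun j p hp => hP2 j p fun h => hp (by simp [P, h])
  have hHP : H = ∑ p ∈ P, -(β p) := by
    rw [hH]
    refine Finset.sum_subset (fun p hp => by simp [P, hp]) fun p _ hp => by rw [hQ p hp, neg_zero]
  let φ : Point → ℤ := fun p => Finset.univ.inf' Finset.univ_nonempty fun j => v p (f j)
  have hφ : ∀ p j, φ p ≤ v p (f j) := fun p j => Finset.inf'_le _ (Finset.mem_univ j)
  have hφ' : ∀ p, ∃ j, v p (f j) = φ p := fun p => by
    obtain ⟨j, _, hj⟩ := Finset.exists_mem_eq_inf' (Finset.univ_nonempty (α := Fin (N + 1)))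
      (fun j => v p (f j))
    exact ⟨j, hj.symm⟩
  let α : Fin (N + 1) → Point → ℤ := fun j p => v p (b j) - β p
  let ε : Fin (N + 1) → Point → ℤ := fun j p => v p (f j) - φ p
  have hα : ∀ j p, 0 ≤ α j p := fun j p => sub_nonneg.2 (hβ p j)
  have hε : ∀ j p, 0 ≤ ε j p := fun j p => sub_nonneg.2 (hφ p j)
  set F : ℤ := ∑ p ∈ P, -(φ p) with hF
  have hsα : ∀ j, ∑ p ∈ P, α j p = H := fun j => by
    simp only [α, Finset.sum_sub_distrib]
    rw [hK.sum_finset (hb j) P (hPb j), hHP, Finset.sum_neg_distrib]; ring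
  have hsε : ∀ j, ∑ p ∈ P, ε j p = F := fun j => by
    simp only [ε, Finset.sum_sub_distrib]
    rw [hK.sum_finset (hf j) P (hPf j), hF, Finset.sum_neg_distrib]; ring
  have hH0 : 0 ≤ H := by rw [← hsα 0]; exact Finset.sum_nonneg fun p _ => hα 0 p
  have hF0 : 0 ≤ F := by rw [← hsε 0]; exact Finset.sum_nonneg fun p _ => hε 0 p
  have hF1 : 1 ≤ F := by
    by_contra hlt
    have hz : F = 0 := by omega
    have hz' : ∀ j, ∀ p ∈ P, ε j p = 0 := fun j =>
      (Finset.sum_eq_zero_iff_of_nonneg fun p _ => hε j p).1 ((hsε j).trans hz)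
    rw [hK.v_div o (hf i0) (hf j0)] at ho
    by_cases hoP : o ∈ P
    · have h1 := hz' i0 o hoP
      have h2 := hz' j0 o hoP
      simp only [ε] at h1 h2
      omega
    · rw [hPf i0 o hoP, hPf j0 o hoP] at ho
      omega
  refine ⟨hH0, ?_⟩
  have hy : ∀ j, b j * f j ^ ℓ ≠ 0 := fun j => mul_ne_zero (hb j) (pow_ne_zero _ (hf j))
  have hcK : ∀ j, algebraMap k K (c j) ≠ 0 := fun j => (map_ne_zero _).2 (hc j)
  let y : Fin (N + 1) → K := fun j => algebraMap k K (c j) * (b j * f j ^ ℓ)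
  have hy0 : ∀ j, y j ≠ 0 := fun j => mul_ne_zero (hcK j) (hy j)
  have hvy : ∀ p j, v p (y j) = v p (b j) + ℓ * v p (f j) := by
    intro p j
    simp only [y]
    rw [hK.v_mul p _ _ (hcK j) (hy j), hK.v_algebraMap p _ (hc j),
      hK.v_mul p _ _ (hb j) (pow_ne_zero _ (hf j)), hK.v_pow p (hf j)]
    ring
  let x : Fin (N + 1) → K := fun j => y j / y 0
  have hx0 : ∀ j, x j ≠ 0 := fun j => div_ne_zero (hy0 j) (hy0 0)
  have hvx : ∀ p j, v p (x j) = (α j p - α 0 p) + ℓ * (ε j p - ε 0 p) := by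
    intro p j
    simp only [x, α, ε]
    rw [hK.v_div p (hy0 j) (hy0 0), hvy, hvy]
    ring
  have hxs : ∑ j, x j = 0 := by
    simp only [x]
    rw [← Finset.sum_div]
    have : ∑ j, y j = 0 := by
      rw [← hs]
      exact Finset.sum_congr rfl fun j _ => by rw [Algebra.smul_def]
    rw [this, zero_div]
  have hxli : LinearIndependent k (fun j : Fin N => x j.castSucc) := by
    rw [Fintype.linearIndependent_iff] at hli ⊢
    intro g hg j
    have := hli (fun j => g j * c j.castSucc) (by
      have h1 : (∑ j : Fin N, g j • x j.castSucc) * y 0 = 0 := by rw [hg, zero_mul]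
      rw [Finset.sum_mul] at h1
      rw [← h1]
      refine Finset.sum_congr rfl fun j _ => ?_
      have hxy : x j.castSucc * y 0 = y j.castSucc := div_mul_cancel₀ _ (hy0 0)
      rw [smul_mul_assoc, hxy]
      simp only [y, Algebra.smul_def, map_mul]
      ring) j
    exact (mul_eq_zero.1 this).resolve_right (hc _)
  let S : Finset Point := P.filter fun p => ∃ j, α j p ≠ 0 ∨ ε j p ≠ 0
  have hSn : ∀ p ∉ S, ∀ j, α j p = 0 ∧ ε j p = 0 := by
    intro p hp j
    by_cases hpP : p ∈ P
    · by_contra h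
      apply hp
      simp only [S, Finset.mem_filter]
      refine ⟨hpP, j, ?_⟩
      tauto
    · obtain ⟨j', hj'⟩ := hφ' p
      rw [hPf j' p hpP] at hj'
      simp only [α, ε]
      rw [hPb j p hpP, hPf j p hpP, hPQ p hpP, ← hj']
      simp
  let μ : Point → ℤ := fun p => (∑ i, α i p) - α 0 p - ℓ * ε 0 p
  have hcore := core hK o x hx0 hxs hxli S (by
      intro p hp j
      rw [hvx, (hSn p hp j).1, (hSn p hp j).2, (hSn p hp 0).1, (hSn p hp 0).2]; simp) μ (by
      intro p _
      obtain ⟨j, hj⟩ := hφ' p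
      refine ⟨j, ?_⟩
      have h1 : ε j p = 0 := by simp only [ε]; omega
      have h2 : α j p ≤ ∑ i, α i p :=
        Finset.single_le_sum (f := fun i => α i p) (fun i _ => hα i p) (Finset.mem_univ j)
      rw [hvx, h1]
      simp only [μ]
      linarith)
  rw [← hT] at hcore
  have hSP : S ⊆ P := Finset.filter_subset _ _
  have hμs : ∑ p ∈ S, -(μ p) = ℓ * F - N * H := by
    have h1 : ∑ p ∈ S, -(μ p) = ∑ p ∈ P, -(μ p) := by
      refine Finset.sum_subset hSP fun p _ hp => ?_
      simp only [μ]
      rw [(hSn p hp 0).1, (hSn p hp 0).2, Finset.sum_eq_zero fun i _ => (hSn p hp i).1]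
      simp
    rw [h1, Finset.sum_neg_distrib]
    simp only [μ, Finset.sum_sub_distrib]
    rw [Finset.sum_comm, ← Finset.mul_sum, hsα 0, hsε 0, Finset.sum_congr rfl fun i _ => hsα i]
    simp only [Finset.sum_const, Finset.card_univ, Fintype.card_fin, nsmul_eq_mul]
    push_cast
    ring
  have hScard : (S.card : ℤ) ≤ (N + 1) * (H + F) := by
    have h1 : (S.card : ℤ) ≤ ∑ p ∈ S, ∑ j, (α j p + ε j p) := by
      rw [Finset.card_eq_sum_ones]
      push_cast
      refine Finset.sum_le_sum fun p hp => ?_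
      obtain ⟨j, hj⟩ := (Finset.mem_filter.1 hp).2
      have h2 : α j p + ε j p ≤ ∑ j, (α j p + ε j p) :=
        Finset.single_le_sum (f := fun j => α j p + ε j p)
          (fun i _ => add_nonneg (hα i p) (hε i p)) (Finset.mem_univ j)
      have h3 := hα j p
      have h4 := hε j p
      omega
    have h2 : ∑ p ∈ S, ∑ j, (α j p + ε j p) ≤ ∑ p ∈ P, ∑ j, (α j p + ε j p) :=
      Finset.sum_le_sum_of_subset_of_nonneg hSP fun p _ _ =>
        Finset.sum_nonneg fun j _ => add_nonneg (hα j p) (hε j p)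
    rw [Finset.sum_comm (s := P)] at h2
    simp only [Finset.sum_add_distrib] at h2
    rw [Finset.sum_congr rfl fun i _ => hsα i, Finset.sum_congr rfl fun i _ => hsε i] at h2
    simp only [Finset.sum_const, Finset.card_univ, Fintype.card_fin, nsmul_eq_mul] at h2
    simp only [Finset.sum_add_distrib] at h1
    push_cast at h2
    linarith
  rw [hμs] at hcore
  have hT0 : (0 : ℤ) ≤ T := Int.natCast_nonneg T
  have hN0 : (0 : ℤ) ≤ N := Int.natCast_nonneg N
  set G : ℤ := max 0 (2 * (genus : ℤ) - 2) with hG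
  have hG0 : 0 ≤ G := le_max_left _ _
  have hG1 : 2 * (genus : ℤ) - 2 ≤ G := le_max_right _ _
  have hTc : (T : ℤ) * (S.card + 2 * genus - 2) ≤ T * ((N + 1) * (H + F) + G) :=
    mul_le_mul_of_nonneg_left (by linarith) hT0
  have hfin : (ℓ : ℤ) * F ≤ ((N + T * (N + 1)) * H + T * G) + T * (N + 1) * F := by nlinarith
  have hX : 0 ≤ (N + T * (N + 1)) * H + T * G := by positivity
  have h5 : (ℓ : ℤ) * F ≤ ((N + T * (N + 1)) * H + T * (N + 1) + T * G) * F := by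
    nlinarith [mul_le_mul_of_nonneg_left hF1 hX]
  exact le_of_mul_le_mul_right h5 (by omega)

theorem numeric (N n T H g ℓ : ℤ) (hN : 1 ≤ N) (hn : N + 1 ≤ n) (hT : 2 * T = N * (N - 1)) (hH : 0 ≤ H)
    (hg : 0 ≤ g)
    (h : ℓ ≤ (N + T * (N + 1)) * H + T * (N + 1) + T * max 0 (2 * g - 2)) :
    ℓ ≤ (n - 1) ^ 2 * (n - 2) * max 1 g + (n - 1) ^ 4 * H := by
  have hG : max 0 (2 * g - 2) = 2 * max 1 g - 2 := by
    rcases le_total 1 g with h | h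
    · rw [max_eq_right h, max_eq_right (by linarith)]
    · rw [max_eq_left h, max_eq_left (by linarith)]; ring
  rw [hG] at h
  set G := max 1 g with hGdef
  have hG1 : 1 ≤ G := le_max_left _ _
  have h1 : N + T * (N + 1) ≤ N ^ 4 := by
    have e1 : 2 * (N + T * (N + 1)) = N + N ^ 3 := by linear_combination (N + 1) * hT
    have e2 : N ≤ N ^ 3 := by nlinarith [mul_nonneg (by linarith : 0 ≤ N) (by nlinarith : 0 ≤ N ^ 2 - 1)]
    have e3 : N ^ 3 ≤ N ^ 4 := by nlinarith [pow_pos (by linarith : 0 < N) 3]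
    linarith
  have h2 : N ^ 4 ≤ (n - 1) ^ 4 := pow_le_pow_left₀ (by linarith) (by linarith) 4
  have h3 : T * (N + 1) + T * (2 * G - 2) ≤ N ^ 2 * (N - 1) * G := by
    have e1 : 2 * (T * (N + 1) + T * (2 * G - 2)) = N * (N - 1) * (N - 1 + 2 * G) := by
      linear_combination (N - 1 + 2 * G) * hT
    have e2 : N - 1 + 2 * G ≤ 2 * (N * G) := by nlinarith
    have e3 : 0 ≤ N * (N - 1) := mul_nonneg (by linarith) (by linarith)
    have e4 := mul_le_mul_of_nonneg_left e2 e3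
    nlinarith
  have h4 : N ^ 2 * (N - 1) ≤ (n - 1) ^ 2 * (n - 2) := by
    have e1 : N ^ 2 ≤ (n - 1) ^ 2 := pow_le_pow_left₀ (by linarith) (by linarith) 2
    exact mul_le_mul e1 (by linarith) (by linarith) (by positivity)
  have h5 := mul_le_mul_of_nonneg_right h4 (by linarith : 0 ≤ G)
  have h6 := mul_le_mul_of_nonneg_right (h1.trans h2) hH
  linarith

theorem circuit {ι : Type*} [Fintype ι] (y : ι → K) (hy : ∀ i, y i ≠ 0)
    (hdep : ¬ LinearIndependent k y) :
    ∃ (N : ℕ) (e : Fin (N + 1) → ι) (c : Fin (N + 1) → k), Function.Injective e ∧ 1 ≤ N ∧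
      (∀ j, c j ≠ 0) ∧ ∑ j, c j • y (e j) = 0 ∧
      LinearIndependent k (fun j : Fin N => y (e j.castSucc)) := by
  let A : Finset (Finset ι) := Finset.univ.filter fun J => ¬ LinearIndependent k (fun i : J => y i)
  have hA : A.Nonempty := by
    refine ⟨Finset.univ, ?_⟩
    simp only [A, Finset.mem_filter, Finset.mem_univ, true_and]
    intro h
    apply hdep
    exact h.comp (fun i => (⟨i, Finset.mem_univ i⟩ : (Finset.univ : Finset ι)))
      (fun i j hij => by simpa using hij)
  obtain ⟨J, hJ, hmin⟩ := Finset.exists_min_image A Finset.card hA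
  have hJd : ¬ LinearIndependent k (fun i : J => y i) := (Finset.mem_filter.1 hJ).2
  have herase : ∀ i ∈ J, LinearIndependent k (fun j : (J.erase i : Finset ι) => y j) := by
    intro i hi
    by_contra h
    have := hmin (J.erase i) (by simp only [A, Finset.mem_filter, Finset.mem_univ, true_and]; exact h)
    rw [Finset.card_erase_of_mem hi] at this
    have := Finset.card_pos.2 ⟨i, hi⟩
    omega
  have hJne : J.Nonempty := by
    rw [Finset.nonempty_iff_ne_empty]
    rintro rfl
    exact hJd linearIndependent_empty_type
  obtain ⟨N, hN⟩ : ∃ N, J.card = N + 1 := ⟨J.card - 1, by have := hJne.card_pos; omega⟩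
  let E : Fin (N + 1) ≃ J := (J.equivFinOfCardEq hN).symm
  have hEi : Function.Injective (fun j => (E j : ι)) :=
    Subtype.val_injective.comp E.injective
  have hlin : ∀ i0 : Fin (N + 1), ∀ g : Fin (N + 1) → k, g i0 = 0 → ∑ j, g j • y (E j) = 0 → g = 0 := by
    intro i0 g hg0 hg
    have h1 := herase (E i0) (E i0).2
    rw [Fintype.linearIndependent_iff] at h1
    have hsum : ∑ i : (J.erase (E i0) : Finset ι),
        g (E.symm ⟨i, Finset.mem_of_mem_erase i.2⟩) • y i = 0 := by
      rw [← hg, ← Finset.sum_erase Finset.univ (a := i0) (by rw [hg0, zero_smul])]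
      symm
      refine Finset.sum_bij (fun j hj => (⟨E j, Finset.mem_erase.2
        ⟨fun h => Finset.ne_of_mem_erase hj (hEi h), (E j).2⟩⟩ : (J.erase (E i0) : Finset ι)))
        (fun _ _ => Finset.mem_univ _) ?_ ?_ ?_
      · intro a _ b _ h
        have h' := Subtype.ext_iff.1 h
        exact hEi h'
      · intro b _
        refine ⟨E.symm ⟨b, Finset.mem_of_mem_erase b.2⟩, ?_, ?_⟩
        · refine Finset.mem_erase.2 ⟨fun h => ?_, Finset.mem_univ _⟩
          apply Finset.ne_of_mem_erase b.2
          have h' := congrArg (fun j => (E j : ι)) h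
          simpa using h'
        · ext; simp
      · intro a _
        simp
    funext j
    by_cases hj : j = i0
    · rw [hj, hg0]; rfl
    · have := h1 _ hsum ⟨E j, Finset.mem_erase.2 ⟨fun h => hj (hEi h), (E j).2⟩⟩
      simpa using this
  obtain ⟨g, hg, i1, hi1⟩ := Fintype.not_linearIndependent_iff.1 hJd
  have hgs : ∑ j, g (E j) • y (E j) = 0 := by
    rw [← hg]; exact Equiv.sum_comp E (fun i => g i • y i)
  have hgn : ∀ j, g (E j) ≠ 0 := by
    intro j hj
    have := congrFun (hlin j (fun j => g (E j)) hj hgs) (E.symm i1)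
    simp at this
    exact hi1 this
  refine ⟨N, fun j => E j, fun j => g (E j), hEi, ?_, hgn, hgs, ?_⟩
  · by_contra hN1
    have : N = 0 := by omega
    subst this
    rw [Fin.sum_univ_one] at hgs
    rcases smul_eq_zero.1 hgs with h | h
    · exact hgn 0 h
    · exact hy _ h
  · rw [Fintype.linearIndependent_iff]
    intro a ha j
    have := congrFun (hlin (Fin.last N) (Fin.snoc a 0) (by simp) (by
      rw [Fin.sum_univ_castSucc]; simpa using ha)) j.castSucc
    simpa using this

theorem IsConst.mul {x y : K} (hx : IsConst k x) (hy : IsConst k y) : IsConst k (x * y) := by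
  obtain ⟨c, rfl⟩ := hx
  obtain ⟨d, rfl⟩ := hy
  exact ⟨c * d, by rw [map_mul]⟩

theorem IsConst.inv {x : K} (hx : IsConst k x) : IsConst k x⁻¹ := by
  obtain ⟨c, rfl⟩ := hx
  exact ⟨c⁻¹, by rw [map_inv₀]⟩

theorem height_eq [CharZero k] (hK : IsFunctionField k v genus) {n : ℕ} (hn : 2 ≤ n)
    (a : Fin n → K) (ha : ∀ i, a i ≠ 0) :
    ∃ (β : Point → ℤ) (Q : Finset Point), (∀ p j, β p ≤ v p (a j)) ∧ (∀ p ∉ Q, β p = 0) ∧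
      heightProj v a = ∑ p ∈ Q, -(β p) := by
  have hne : (Finset.univ : Finset (Fin n)).Nonempty := ⟨⟨0, by omega⟩, Finset.mem_univ _⟩
  obtain ⟨Q, hQ⟩ := hK.exists_supp_fin ha
  have hz : ∀ p ∉ Q, Finset.univ.inf' hne (fun j => v p (a j)) = 0 := by
    intro p hp
    have : (fun j => v p (a j)) = fun _ => 0 := by
      funext j; exact hQ j p hp
    rw [this, Finset.inf'_const]
  refine ⟨fun p => Finset.univ.inf' hne (fun j => v p (a j)), Q, ?_, hz, ?_⟩
  · intro p j
    exact Finset.inf'_le (fun j => v p (a j)) (Finset.mem_univ j)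
  · unfold heightProj
    rw [finsum_eq_sum_of_support_subset (s := Q)]
    · apply Finset.sum_congr rfl
      intro p _
      rw [dif_pos hne]
    · intro p hp
      by_contra hpQ
      apply hp
      show -(dite _ _ _) = (0 : ℤ)
      rw [dif_pos hne, hz p (by simpa using hpQ), neg_zero]

theorem green_aux [CharZero k] (hK : IsFunctionField k v genus)
    (n : ℕ) (hn : 2 ≤ n) (ℓ : ℕ)
    (a f : Fin n → K) (ha : ∀ i, a i ≠ 0) (hf : ∀ i, f i ≠ 0)
    (hsum : ∑ i, a i * f i ^ ℓ = 0)
    (hsub : ∀ I : Finset (Fin n), I.Nonempty → I ≠ Finset.univ →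
      ∑ i ∈ I, a i * f i ^ ℓ ≠ 0)
    (i0 j0 : Fin n) (hij : ¬ IsConst k (f i0 / f j0)) :
    (ℓ : ℤ) ≤ ((n : ℤ) - 1) ^ 2 * ((n : ℤ) - 2) * max 1 (genus : ℤ)
        + ((n : ℤ) - 1) ^ 4 * heightProj v a := by
  obtain ⟨β, Q, hβ, hQ, hH⟩ := height_eq hK hn a ha
  let S : Setoid (Fin n) :=
    { r := fun i j => IsConst k (f i / f j)
      iseqv := ⟨fun i => ⟨1, by rw [map_one, div_self (hf i)]⟩,
        fun {i j} h => by rw [← inv_div]; exact h.inv,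
        fun {i j l} h1 h2 => by
          have := h1.mul h2
          rwa [div_mul_div_cancel₀ (hf j)] at this⟩ }
  let cl : Fin n → Quotient S := fun i => Quotient.mk S i
  have hcl : ∀ i, IsConst k (f i / f (cl i).out) := by
    intro i
    have h : S.r (cl i).out i := Quotient.mk_out (s := S) i
    exact S.symm h
  have hclne : ∀ s t : Quotient S, s ≠ t → ¬ IsConst k (f s.out / f t.out) := by
    intro s t hst h
    apply hst
    have h' : S.r s.out t.out := h
    rw [← Quotient.out_eq s, ← Quotient.out_eq t]
    exact Quotient.sound h'
  let F : Quotient S → Finset (Fin n) := fun s => Finset.univ.filter fun i => cl i = s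
  let b : Quotient S → K := fun s => ∑ i ∈ F s, a i * (f i / f s.out) ^ ℓ
  let y : Quotient S → K := fun s => b s * f s.out ^ ℓ
  have hy : ∀ s, y s = ∑ i ∈ F s, a i * f i ^ ℓ := by
    intro s
    show (∑ i ∈ F s, a i * (f i / f s.out) ^ ℓ) * f s.out ^ ℓ = _
    rw [Finset.sum_mul]
    refine Finset.sum_congr rfl fun i _ => ?_
    rw [mul_assoc, ← mul_pow, div_mul_cancel₀ _ (hf _)]
  have hy0 : ∀ s, y s ≠ 0 := by
    intro s
    rw [hy]
    apply hsub
    · exact ⟨s.out, Finset.mem_filter.2 ⟨Finset.mem_univ _, Quotient.out_eq s⟩⟩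
    · intro h
      have h1 : i0 ∈ F s := by rw [h]; exact Finset.mem_univ _
      have h2 : j0 ∈ F s := by rw [h]; exact Finset.mem_univ _
      have h3 : cl i0 = cl j0 := (Finset.mem_filter.1 h1).2.trans (Finset.mem_filter.1 h2).2.symm
      have h4 : S.r i0 j0 := Quotient.exact h3
      exact hij h4
  have hb0 : ∀ s, b s ≠ 0 := fun s h => hy0 s (by show b s * _ = 0; rw [h, zero_mul])
  have hys : ∑ s, y s = 0 := by
    rw [← hsum, ← Finset.sum_fiberwise Finset.univ cl]
    exact Finset.sum_congr rfl fun s _ => hy s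
  have hdep : ¬ LinearIndependent k y := by
    rw [Fintype.not_linearIndependent_iff]
    exact ⟨fun _ => 1, by simpa using hys, cl i0, one_ne_zero⟩
  obtain ⟨N, e, c, he, hN, hc, hs, hli⟩ := circuit y hy0 hdep
  have hcard : N + 1 ≤ n := by
    have h1 := Fintype.card_le_of_injective e he
    have h2 := Fintype.card_le_of_surjective cl Quotient.mk_surjective
    simp only [Fintype.card_fin] at h1 h2
    omega
  have hβb : ∀ p j, β p ≤ v p (b (e j)) := by
    intro p j
    refine (hK.ge_sum (F (e j)) _ fun i hi => ?_ : Ge v p (β p) (b (e j))).le (hb0 _)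
    obtain ⟨d, hd⟩ := hcl i
    rw [(Finset.mem_filter.1 hi).2] at hd
    rw [← hd, ← map_pow, mul_comm]
    exact hK.ge_cmul _ ((ge_self p (a i)).mono (hβ p i))
  have hne : e 0 ≠ e (Fin.last N) := by
    intro h
    have := congrArg Fin.val (he h)
    simp at this
    omega
  obtain ⟨h0, h1⟩ := bound hK ℓ (fun j => b (e j)) (fun j => f (e j).out) (fun j => hb0 _)
    (fun j => hf _) c hc hs hli 0 (Fin.last N) (hclne _ _ hne) β hβb Q hQ (heightProj v a) hH
    (∑ i ∈ Finset.range N, i) rfl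
  refine numeric N n _ _ genus ℓ (by exact_mod_cast hN) (by exact_mod_cast hcard) ?_ h0
    (by positivity) h1
  have h2 := Finset.sum_range_id_mul_two N
  obtain ⟨M, rfl⟩ : ∃ M, N = M + 1 := ⟨N - 1, by omega⟩
  have h3 : ((∑ i ∈ Finset.range (M + 1), i : ℕ) : ℤ) * 2 = ((M : ℤ) + 1) * M := by
    have := congrArg (Nat.cast : ℕ → ℤ) h2
    rw [Nat.add_sub_cancel, Nat.cast_mul, Nat.cast_mul] at this
    exact_mod_cast this
  push_cast at h3 ⊢
  linarith

end Aux

/-- **Corollary 2.2 (Green's lemma analogue).** If `a_1 f_1^ℓ + ⋯ + a_n f_n^ℓ = 0` with no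
proper vanishing subsum and `ℓ > (n−1)²(n−2)·max{1,𝔤} + (n−1)⁴·h(a_1,…,a_n)`, then all the
ratios `f_i/f_j` are constants. -/
theorem green_lemma
    (k K Point : Type*) [Field k] [Field K] [Algebra k K] [IsAlgClosed k] [CharZero k]
    (v : Point → K → ℤ) (genus : ℕ) (hK : IsFunctionField k v genus)
    (n : ℕ) (hn : 2 ≤ n) (ℓ : ℕ) (hℓpos : 0 < ℓ)
    (a f : Fin n → K) (ha : ∀ i, a i ≠ 0) (hf : ∀ i, f i ≠ 0)
    (hsum : ∑ i, a i * f i ^ ℓ = 0)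
    (hsub : ∀ I : Finset (Fin n), I.Nonempty → I ≠ Finset.univ →
      ∑ i ∈ I, a i * f i ^ ℓ ≠ 0)
    (hℓ : ((n : ℤ) - 1) ^ 2 * ((n : ℤ) - 2) * max 1 (genus : ℤ)
        + ((n : ℤ) - 1) ^ 4 * heightProj v a < (ℓ : ℤ)) :
    ∀ i j, IsConst k (f i / f j) := by
  intro i j
  by_contra hij
  exact absurd (green_aux hK n hn ℓ a f ha hf hsum hsub i j hij) (not_le.2 hℓ)

end FunctionFieldGCD
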